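/- For all integers ℓ > q ≥ 1, every q-zigzagged (ℓ+1)-ample (in the strengthened sense) (2(q+2)(q+ℓ+2), (2ℓ+3)ℓ+2)-constellation contains both T_{2,ℓ} ∪ ℓ·T_{1,ℓ} and T_{3,ℓ} ∪ ℓ·T_{1,ℓ} as induced minors. -/

import Mathlib

open SimpleGraph

namespace Paper

variable {V W : Type*}

/-- `H` occurs as a subgraph of `G`: an injective map preserving adjacency. -/
def HasSubgraphCopy (G : SimpleGraph V) (H : SimpleGraph W) : Prop :=
  ∃ f : W → V, Function.Injective f ∧ ∀ u v, H.Adj u v → G.Adj (f u) (f v)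

/-- The complete bipartite graph `K_{t,t}`. -/
def Ktt (t : ℕ) : SimpleGraph (Fin t ⊕ Fin t) := completeBipartiteGraph (Fin t) (Fin t)

/-- The claw `K_{1,3}`. -/
def clawGraph : SimpleGraph (Fin 1 ⊕ Fin 3) := completeBipartiteGraph (Fin 1) (Fin 3)

/-- An induced minor model of `H` in `G`: pairwise disjoint nonempty connected branch
sets such that there is an edge between two branch sets iff the corresponding vertices
of `H` are adjacent. -/
def IsInducedMinorModel (H : SimpleGraph W) (G : SimpleGraph V) (M : W → Set V) : Prop :=
  (∀ v, (M v).Nonempty) ∧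
  (∀ v, (G.induce (M v)).Connected) ∧
  (Pairwise fun u v => Disjoint (M u) (M v)) ∧
  (∀ u v, u ≠ v → ((∃ a ∈ M u, ∃ b ∈ M v, G.Adj a b) ↔ H.Adj u v))

/-- `H` is an induced minor of `G`. -/
def InducedMinor (H : SimpleGraph W) (G : SimpleGraph V) : Prop :=
  ∃ M : W → Set V, IsInducedMinorModel H G M

/-- `G` admits a path-decomposition of width at most `w`. -/
def HasPWAtMost (G : SimpleGraph V) (w : ℕ) : Prop :=
  ∃ (m : ℕ) (B : Fin (m + 1) → Set V),
    (∀ v, ∃ i, v ∈ B i) ∧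
    (∀ u v, G.Adj u v → ∃ i, u ∈ B i ∧ v ∈ B i) ∧
    (∀ v, ∀ i j k : Fin (m + 1), i ≤ j → j ≤ k → v ∈ B i → v ∈ B k → v ∈ B j) ∧
    (∀ i, (B i).ncard ≤ w + 1)

/-- The pathwidth of `G`. -/
noncomputable def pathwidth (G : SimpleGraph V) : ℕ := sInf {w | HasPWAtMost G w}

/-- A class of (finite) graphs. -/
abbrev GraphClass := Set ((n : ℕ) × SimpleGraph (Fin n))

/-- A class of graphs is weakly sparse if it excludes some biclique `K_{t,t}` as a subgraph. -/
def WeaklySparseClass (𝒞 : GraphClass) : Prop :=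
  ∃ t : ℕ, 1 ≤ t ∧ ∀ G ∈ 𝒞, ¬ HasSubgraphCopy G.2 (Ktt t)

/-- A class of graphs has bounded pathwidth. -/
def BddPathwidth (𝒞 : GraphClass) : Prop :=
  ∃ w : ℕ, ∀ G ∈ 𝒞, pathwidth G.2 ≤ w

/-- A graph `H` is positive if every weakly sparse class of graphs excluding `H` as an
induced minor has bounded pathwidth. -/
def IsPositive (H : SimpleGraph W) : Prop :=
  ∀ 𝒞 : GraphClass, WeaklySparseClass 𝒞 → (∀ G ∈ 𝒞, ¬ InducedMinor H G.2) →
    BddPathwidth 𝒞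

/-- A graph `H` is negative if some weakly sparse class of graphs excluding `H` as an
induced minor has unbounded pathwidth. -/
def IsNegative (H : SimpleGraph W) : Prop :=
  ∃ 𝒞 : GraphClass, WeaklySparseClass 𝒞 ∧ (∀ G ∈ 𝒞, ¬ InducedMinor H G.2) ∧
    ¬ BddPathwidth 𝒞

/-- The closed neighborhood of a set of vertices. -/
def closedNbhd (G : SimpleGraph V) (S : Set V) : Set V :=
  {x | x ∈ S ∨ ∃ s ∈ S, G.Adj s x}

/-- The set `A` induces a claw in `G`. -/
def IsClawSet (G : SimpleGraph V) (A : Set V) : Prop :=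
  Nonempty ((G.induce A) ≃g clawGraph)

/-- `v` is the center of the claw induced by `A`. -/
def IsClawCenter (G : SimpleGraph V) (A : Set V) (v : V) : Prop :=
  v ∈ A ∧ ∀ u ∈ A, u ≠ v → G.Adj v u

/-- `v` is a leaf of the claw induced by `A`. -/
def IsClawLeaf (G : SimpleGraph V) (A : Set V) (v : V) : Prop :=
  v ∈ A ∧ ¬ IsClawCenter G A v

/-- `G` is (isomorphic to) a path graph. -/
def IsPathGraph (G : SimpleGraph V) : Prop :=
  ∃ n : ℕ, Nonempty (G ≃g pathGraph n)

/-- Any two vertices of `Y` and `Z` are joined by a walk avoiding `S`. -/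
def SameComponentAvoiding (G : SimpleGraph V) (Y Z S : Set V) : Prop :=
  ∀ u ∈ Y, ∀ v ∈ Z, ∃ p : G.Walk u v, ∀ x ∈ p.support, x ∉ S

/-- Some vertex of `Y` is joined to some vertex of `Z` by a walk avoiding `S`. -/
def ConnectsAvoiding (G : SimpleGraph V) (Y Z S : Set V) : Prop :=
  ∃ u ∈ Y, ∃ v ∈ Z, ∃ p : G.Walk u v, ∀ x ∈ p.support, x ∉ S

/-- There is an `A`–`B` path all of whose vertices avoid `S`. -/
def PathBetweenAvoiding (G : SimpleGraph V) (A B S : Set V) : Prop :=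
  ∃ a ∈ A, ∃ b ∈ B, ∃ p : G.Walk a b, p.IsPath ∧ ∀ x ∈ p.support, x ∉ S

/-- `a`, `b`, `c` form an asteroidal triple in `G`. -/
def AsteroidalTriple (G : SimpleGraph V) (a b c : V) : Prop :=
  a ≠ b ∧ a ≠ c ∧ b ≠ c ∧ ¬ G.Adj a b ∧ ¬ G.Adj a c ∧ ¬ G.Adj b c ∧
  ConnectsAvoiding G {a} {b} (closedNbhd G {c}) ∧
  ConnectsAvoiding G {a} {c} (closedNbhd G {b}) ∧
  ConnectsAvoiding G {b} {c} (closedNbhd G {a})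

/-- Selector for three sets. -/
def pick3 (A B C : Set V) : Fin 3 → Set V :=
  fun i => if i = 0 then A else if i = 1 then B else C

/-- The graph obtained from `G` by contracting each of the three disjoint sets
`A`, `B`, `C` into a single vertex. -/
def contractThree (G : SimpleGraph V) (A B C : Set V) :
    SimpleGraph ({x : V // x ∉ A ∪ B ∪ C} ⊕ Fin 3) :=
  SimpleGraph.fromRel (fun a b =>
    match a, b with
    | Sum.inl x, Sum.inl y => G.Adj x.1 y.1
    | Sum.inl x, Sum.inr i => ∃ s ∈ pick3 A B C i, G.Adj x.1 s
    | Sum.inr i, Sum.inr j => ∃ s ∈ pick3 A B C i, ∃ t ∈ pick3 A B C j, G.Adj s t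
    | Sum.inr _, Sum.inl _ => False)

/-- Three pairwise disjoint claws whose contraction into single vertices `a`, `b`, `c`
yields a forest in which `a`, `b`, `c` form an asteroidal triple. -/
def ThreeClawsConfig (F : SimpleGraph V) : Prop :=
  ∃ A B C : Set V, IsClawSet F A ∧ IsClawSet F B ∧ IsClawSet F C ∧
    Disjoint A B ∧ Disjoint A C ∧ Disjoint B C ∧
    (contractThree F A B C).IsAcyclic ∧
    AsteroidalTriple (contractThree F A B C) (Sum.inr 0) (Sum.inr 1) (Sum.inr 2)

/-- There is at most one edge of `G` between `S` and `T`. -/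
def AtMostOneCrossEdge (G : SimpleGraph V) (S T : Set V) : Prop :=
  ∀ x ∈ S, ∀ y ∈ T, G.Adj x y → ∀ x' ∈ S, ∀ y' ∈ T, G.Adj x' y' → x = x' ∧ y = y'

/-- Four pairwise disjoint claws `A`, `B`, `C`, `D`, an `A`–`B` path avoiding `N[C ∪ D]`,
a `C`–`D` path avoiding `N[A ∪ B]`, and at most one edge between `A ∪ B` and `C ∪ D`. -/
def FourClawsCore (H : SimpleGraph V) (A B C D : Set V) : Prop :=
  IsClawSet H A ∧ IsClawSet H B ∧ IsClawSet H C ∧ IsClawSet H D ∧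
  Disjoint A B ∧ Disjoint A C ∧ Disjoint A D ∧
  Disjoint B C ∧ Disjoint B D ∧ Disjoint C D ∧
  PathBetweenAvoiding H A B (closedNbhd H (C ∪ D)) ∧
  PathBetweenAvoiding H C D (closedNbhd H (A ∪ B)) ∧
  AtMostOneCrossEdge H (A ∪ B) (C ∪ D)

/-- Four-claw configuration in which the possible edge between `A ∪ B` and `C ∪ D` joins
a leaf of one of the claws `A`, `B` to a leaf of one of the claws `C`, `D`. -/
def NdsConfig (H : SimpleGraph V) (A B C D : Set V) : Prop :=
  FourClawsCore H A B C D ∧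
  ∀ x ∈ A ∪ B, ∀ y ∈ C ∪ D, H.Adj x y →
    (IsClawLeaf H A x ∨ IsClawLeaf H B x) ∧ (IsClawLeaf H C y ∨ IsClawLeaf H D y)

/-- Four-claw configuration in which the possible edge between `A ∪ B` and `C ∪ D` is not
incident to any of the four claw centers. -/
def NdsConfigCenters (H : SimpleGraph V) (A B C D : Set V) : Prop :=
  FourClawsCore H A B C D ∧
  ∀ x ∈ A ∪ B, ∀ y ∈ C ∪ D, H.Adj x y → ∀ c : V,
    (IsClawCenter H A c ∨ IsClawCenter H B c ∨ IsClawCenter H C c ∨ IsClawCenter H D c) →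
    x ≠ c ∧ y ≠ c

/-- Configuration of three sets as in the Pohoata–Davies grid lemma. -/
def NpdConfig (H : SimpleGraph V) (A B C : Set V) : Prop :=
  A.Nonempty ∧ B.Nonempty ∧ C.Nonempty ∧
  ∀ i : Fin 3,
    (∀ j : Fin 3, j ≠ i → Disjoint (closedNbhd H (pick3 A B C i)) (pick3 A B C j)) ∧
    (H.induce (pick3 A B C i)).Connected ∧
    ¬ IsPathGraph (H.induce (pick3 A B C i)) ∧
    ∀ j k : Fin 3, j ≠ i → k ≠ i →
      SameComponentAvoiding H (pick3 A B C j) (pick3 A B C k)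
        (closedNbhd H (pick3 A B C i))

/-- The `n × n` Pohoata–Davies grid: `n` paths on `n` vertices each (vertex `(j, i)` is
the `i`-th vertex of the `j`-th path), together with, for each `i`, a star vertex
adjacent to the `i`-th vertex of each path. -/
def pdGrid (n : ℕ) : SimpleGraph (Fin n × Fin n ⊕ Fin n) :=
  SimpleGraph.fromRel (fun a b =>
    match a, b with
    | Sum.inl p, Sum.inl q => p.1 = q.1 ∧ (p.2 : ℕ) + 1 = (q.2 : ℕ)
    | Sum.inl p, Sum.inr s => p.2 = s
    | _, _ => False)

/-- The death star of height `n`: its path has `2^n - 1` vertices, and the star vertex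
added at height `k+1` (for `k : Fin n`) is adjacent exactly to the path vertices `i`
with `i ≡ 2^(n-1-k) - 1 (mod 2^(n-k))`. -/
def deathStar (n : ℕ) : SimpleGraph (Fin (2 ^ n - 1) ⊕ Fin n) :=
  SimpleGraph.fromRel (fun a b =>
    match a, b with
    | Sum.inl i, Sum.inl j => (i : ℕ) + 1 = (j : ℕ)
    | Sum.inl i, Sum.inr k => (i : ℕ) % 2 ^ (n - (k : ℕ)) = 2 ^ (n - 1 - (k : ℕ)) - 1
    | _, _ => False)

/-- The tree `T_{1,ℓ}`: a root adjacent to the central vertex of each of `ℓ` disjoint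
paths on `2ℓ + 1` vertices. -/
def T1Graph (ℓ : ℕ) : SimpleGraph (Unit ⊕ Fin ℓ × Fin (2 * ℓ + 1)) :=
  SimpleGraph.fromRel (fun a b =>
    match a, b with
    | Sum.inl _, Sum.inr p => (p.2 : ℕ) = ℓ
    | Sum.inr p, Sum.inr q => p.1 = q.1 ∧ (p.2 : ℕ) + 1 = (q.2 : ℕ)
    | _, _ => False)

/-- Vertices of `T_{2,ℓ}` and `T_{3,ℓ}`: the root; the `ℓ` original leaves adjacent to
the root; the two subdivided paths `x_0, …, x_{ℓ+1}` and `y_0, …, y_{ℓ+1}` (with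
`x = x_0`, `y = y_0` the non-leaf children of the root); three attached `ℓ`-edge paths;
and `ℓ + 3` glued copies of `T_{1,ℓ}` (each consisting of `ℓ` paths on `2ℓ+1` vertices,
the root of the copy being identified with the glue site). -/
abbrev TVert (ℓ : ℕ) : Type :=
  Unit ⊕ Fin ℓ ⊕ (Fin 2 × Fin (ℓ + 2)) ⊕ (Fin 3 × Fin ℓ) ⊕
    (Fin (ℓ + 3) × Fin ℓ × Fin (2 * ℓ + 1))

/-- The `ℓ + 3` glue sites of a copy of `T_{1,ℓ}`: site `0` is `x`; site `1` is the far
end `x_{ℓ+1}`; site `2` is the far end `y_{ℓ+1}`; sites `3, …, ℓ+2` are the `ℓ` original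
leaves adjacent to the root. -/
def glueSite (ℓ : ℕ) (k : Fin (ℓ + 3)) : TVert ℓ :=
  if h : 3 ≤ (k : ℕ) then Sum.inr (Sum.inl ⟨(k : ℕ) - 3, by have := k.isLt; omega⟩)
  else if (k : ℕ) = 0 then Sum.inr (Sum.inr (Sum.inl (0, ⟨0, by omega⟩)))
  else if (k : ℕ) = 1 then Sum.inr (Sum.inr (Sum.inl (0, ⟨ℓ + 1, by omega⟩)))
  else Sum.inr (Sum.inr (Sum.inl (1, ⟨ℓ + 1, by omega⟩)))

/-- Attachment points of the three `ℓ`-edge paths: for both trees, paths `0` and `1` are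
attached at `x_ℓ` and `y_ℓ` (the parents of the two original leaves non-adjacent to the
root); path `2` is attached at the child `x_1` of `x` for `T_{2,ℓ}` (`three = false`)
and at `y = y_0` for `T_{3,ℓ}` (`three = true`). -/
def attachPt (ℓ : ℕ) (three : Bool) (p : Fin 3) : TVert ℓ :=
  if (p : ℕ) = 0 then Sum.inr (Sum.inr (Sum.inl (0, ⟨ℓ, by omega⟩)))
  else if (p : ℕ) = 1 then Sum.inr (Sum.inr (Sum.inl (1, ⟨ℓ, by omega⟩)))
  else if three then Sum.inr (Sum.inr (Sum.inl (1, ⟨0, by omega⟩)))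
  else Sum.inr (Sum.inr (Sum.inl (0, ⟨1, by omega⟩)))

/-- Base adjacency of `T_{2,ℓ}` (`three = false`) and `T_{3,ℓ}` (`three = true`). -/
def TAdj (ℓ : ℕ) (three : Bool) : TVert ℓ → TVert ℓ → Prop := fun a b =>
  match a, b with
  | Sum.inl _, Sum.inr (Sum.inl _) => True
  | Sum.inl _, Sum.inr (Sum.inr (Sum.inl p)) => (p.2 : ℕ) = 0
  | Sum.inr (Sum.inr (Sum.inl p)), Sum.inr (Sum.inr (Sum.inl q)) =>
      p.1 = q.1 ∧ (p.2 : ℕ) + 1 = (q.2 : ℕ)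
  | Sum.inr (Sum.inr (Sum.inr (Sum.inl p))), Sum.inr (Sum.inr (Sum.inr (Sum.inl q))) =>
      p.1 = q.1 ∧ (p.2 : ℕ) + 1 = (q.2 : ℕ)
  | Sum.inr (Sum.inr (Sum.inr (Sum.inr p))), Sum.inr (Sum.inr (Sum.inr (Sum.inr q))) =>
      p.1 = q.1 ∧ p.2.1 = q.2.1 ∧ (p.2.2 : ℕ) + 1 = (q.2.2 : ℕ)
  | x, Sum.inr (Sum.inr (Sum.inr (Sum.inl p))) => (p.2 : ℕ) = 0 ∧ x = attachPt ℓ three p.1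
  | x, Sum.inr (Sum.inr (Sum.inr (Sum.inr p))) => (p.2.2 : ℕ) = ℓ ∧ x = glueSite ℓ p.1
  | _, _ => False

/-- The tree `T_{2,ℓ}`. -/
def T2Graph (ℓ : ℕ) : SimpleGraph (TVert ℓ) := SimpleGraph.fromRel (TAdj ℓ false)

/-- The tree `T_{3,ℓ}`. -/
def T3Graph (ℓ : ℕ) : SimpleGraph (TVert ℓ) := SimpleGraph.fromRel (TAdj ℓ true)

/-- Disjoint union of two graphs. -/
def disjUnion (G : SimpleGraph V) (H : SimpleGraph W) : SimpleGraph (V ⊕ W) :=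
  SimpleGraph.fromRel (fun a b =>
    match a, b with
    | Sum.inl x, Sum.inl y => G.Adj x y
    | Sum.inr x, Sum.inr y => H.Adj x y
    | _, _ => False)

/-- Disjoint union of `m` copies of `G`. -/
def copies (m : ℕ) (G : SimpleGraph V) : SimpleGraph (Fin m × V) :=
  SimpleGraph.fromRel (fun a b => a.1 = b.1 ∧ G.Adj a.2 b.2)

/-- `T_{2,ℓ} ∪ ℓ·T_{1,ℓ}`. -/
def T2Union (ℓ : ℕ) : SimpleGraph (TVert ℓ ⊕ Fin ℓ × (Unit ⊕ Fin ℓ × Fin (2 * ℓ + 1))) :=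
  disjUnion (T2Graph ℓ) (copies ℓ (T1Graph ℓ))

/-- `T_{3,ℓ} ∪ ℓ·T_{1,ℓ}`. -/
def T3Union (ℓ : ℕ) : SimpleGraph (TVert ℓ ⊕ Fin ℓ × (Unit ⊕ Fin ℓ × Fin (2 * ℓ + 1))) :=
  disjUnion (T3Graph ℓ) (copies ℓ (T1Graph ℓ))

/-- Vertices of the infinite tree `T₁`. -/
abbrev T1InfVert : Type := Unit ⊕ ℕ ⊕ (ℕ × Fin 2 × ℕ)

/-- The infinite tree `T₁`: the root has countably many children, each child of the root
has exactly two children, and below these every vertex has exactly one child. -/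
def T1Inf : SimpleGraph T1InfVert :=
  SimpleGraph.fromRel (fun a b =>
    match a, b with
    | Sum.inl _, Sum.inr (Sum.inl _) => True
    | Sum.inr (Sum.inl i), Sum.inr (Sum.inr p) => i = p.1 ∧ p.2.2 = 0
    | Sum.inr (Sum.inr p), Sum.inr (Sum.inr q) =>
        p.1 = q.1 ∧ p.2.1 = q.2.1 ∧ p.2.2 + 1 = q.2.2
    | _, _ => False)

/-- A (finite) tree belongs to `𝒯₁` iff it is isomorphic to a connected induced
subgraph of `T₁`. -/
def MemT1Class (T : SimpleGraph W) : Prop :=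
  ∃ S : Set T1InfVert, (T1Inf.induce S).Connected ∧ Nonempty (T ≃g T1Inf.induce S)

/-- In a tree `T` rooted at `r`, `u` is a (not necessarily strict) ancestor of `v`. -/
def IsAncestor (T : SimpleGraph V) (r u v : V) : Prop :=
  ∃ p : T.Walk r v, p.IsPath ∧ u ∈ p.support

/-- The vertex set of the subtree of `T` (rooted at `r`) rooted at `x`. -/
def rootedSubtree (T : SimpleGraph V) (r x : V) : Set V := {v | IsAncestor T r x v}

/-- The set of vertices `x` whose rooted subtree contains a claw while no subtree rooted
at a strict descendant of `x` contains a claw. -/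
def clawMinimalSet (T : SimpleGraph V) (r : V) : Set V :=
  {x | (∃ A ⊆ rootedSubtree T r x, IsClawSet T A) ∧
    ∀ y, IsAncestor T r x y → y ≠ x → ¬ ∃ A ⊆ rootedSubtree T r y, IsClawSet T A}

/-- `z` is the least common ancestor of `x` and `y` in the tree `T` rooted at `r`. -/
def IsLCA (T : SimpleGraph V) (r x y z : V) : Prop :=
  IsAncestor T r z x ∧ IsAncestor T r z y ∧
    ∀ w, IsAncestor T r w x → IsAncestor T r w y → IsAncestor T r w z

/-- The set of least common ancestors of distinct pairs of `X`. -/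
def lcaSet (T : SimpleGraph V) (r : V) (X : Set V) : Set V :=
  {z | ∃ x ∈ X, ∃ y ∈ X, x ≠ y ∧ IsLCA T r x y z}

/-- `(G, S, L)` is a constellation: `S` is independent, the components of `G - S` are
exactly the paths of `L`, and every vertex of `S` has a neighbor on every path of `L`. -/
structure IsConstellation (G : SimpleGraph V) (S : Set V) (L : Set (Set V)) : Prop where
  indep : S.Pairwise fun x y => ¬ G.Adj x y
  pathsOffS : ∀ P ∈ L, Disjoint P S
  cover : ∀ v, v ∉ S → ∃ P ∈ L, v ∈ P
  pathsDisj : L.Pairwise fun P Q => Disjoint P Q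
  pathsNonempty : ∀ P ∈ L, P.Nonempty
  pathsArePaths : ∀ P ∈ L, IsPathGraph (G.induce P)
  pathsSep : ∀ P ∈ L, ∀ Q ∈ L, P ≠ Q → ∀ u ∈ P, ∀ v ∈ Q, ¬ G.Adj u v
  dominates : ∀ s ∈ S, ∀ P ∈ L, ∃ v ∈ P, G.Adj s v

/-- `(S, L)` has sizes `(s, p)`. -/
def IsSPConst (S : Set V) (L : Set (Set V)) (s p : ℕ) : Prop :=
  S.Finite ∧ S.ncard = s ∧ L.Finite ∧ L.ncard = p

/-- A `C`-route: a nontrivial path whose endpoints are in `S` and whose internal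
vertices avoid `S`. -/
def IsRoute (G : SimpleGraph V) (S : Set V) (x y : V) (p : G.Walk x y) : Prop :=
  x ∈ S ∧ y ∈ S ∧ p.IsPath ∧ 0 < p.length ∧
    ∀ v ∈ p.support, v ≠ x → v ≠ y → v ∉ S

/-- `d`-ample: no route with at most `d + 1` edges. -/
def IsAmple (G : SimpleGraph V) (S : Set V) (d : ℕ) : Prop :=
  ∀ (x y : V) (p : G.Walk x y), IsRoute G S x y p → d + 1 < p.length

/-- `e` is an endpoint of the path induced on `P`. -/
def IsPathEndpoint (G : SimpleGraph V) (P : Set V) (e : V) : Prop :=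
  e ∈ P ∧ {v | v ∈ P ∧ G.Adj e v}.ncard ≤ 1

/-- `d`-ample in the strengthened sense: additionally no vertex of `S` has a neighbor on
a path `P ∈ L` at distance (in `P`) less than `d` from an endpoint of `P`. -/
def IsAmpleStrong (G : SimpleGraph V) (S : Set V) (L : Set (Set V)) (d : ℕ) : Prop :=
  IsAmple G S d ∧
  ∀ s ∈ S, ∀ P ∈ L, ∀ (v : V) (hv : v ∈ P), G.Adj s v →
    ∀ (e : V) (he : e ∈ P), IsPathEndpoint G P e →
      d ≤ (G.induce P).dist ⟨v, hv⟩ ⟨e, he⟩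

/-- `r` is a strict total order on `S`. -/
def StrictTotalOrderOn (S : Set V) (r : V → V → Prop) : Prop :=
  (∀ x ∈ S, ¬ r x x) ∧
  (∀ x ∈ S, ∀ y ∈ S, ∀ z ∈ S, r x y → r y z → r x z) ∧
  (∀ x ∈ S, ∀ y ∈ S, x ≠ y → r x y ∨ r y x)

/-- Interrupted constellation: some total order on `S` such that for every `x ≺ y ≺ z`,
every route between `x` and `y` is adjacent to `z`. -/
def IsInterrupted (G : SimpleGraph V) (S : Set V) : Prop :=
  ∃ r : V → V → Prop, StrictTotalOrderOn S r ∧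
    ∀ x ∈ S, ∀ y ∈ S, ∀ z ∈ S, r x y → r y z →
      ∀ p : G.Walk x y, IsRoute G S x y p → ∃ v ∈ p.support, G.Adj z v

/-- `q`-zigzagged constellation: some total order on `S` such that for every route
between `x` and `y`, fewer than `q` vertices strictly between `x` and `y` have no
neighbor on the route. -/
def IsZigzagged (G : SimpleGraph V) (S : Set V) (q : ℕ) : Prop :=
  ∃ r : V → V → Prop, StrictTotalOrderOn S r ∧
    ∀ x ∈ S, ∀ y ∈ S, ∀ p : G.Walk x y, IsRoute G S x y p →
      {z | z ∈ S ∧ ((r x z ∧ r z y) ∨ (r y z ∧ r z x)) ∧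
        ∀ v ∈ p.support, ¬ G.Adj z v}.ncard < q

/-- Lift a subset of `V` to a subset of the subtype `↥U`. -/
def liftToSub (U : Set V) (T : Set V) : Set ↥U := {v : ↥U | (v : V) ∈ T}

/-- The graph `H'` obtained from `H` by adding a disjoint path on `2ℓ+1` vertices and
joining `u` to the center of this path. -/
def addPendantPath (H : SimpleGraph W) (u : W) (ℓ : ℕ) :
    SimpleGraph (W ⊕ Fin (2 * ℓ + 1)) :=
  SimpleGraph.fromRel (fun a b =>
    match a, b with
    | Sum.inl v, Sum.inl w => H.Adj v w
    | Sum.inl v, Sum.inr i => v = u ∧ (i : ℕ) = ℓ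
    | Sum.inr i, Sum.inr j => (i : ℕ) + 1 = (j : ℕ)
    | Sum.inr _, Sum.inl _ => False)

open SimpleGraph
structure PD {V : Type} {N : ℕ} (G : SimpleGraph V) (σ : Fin N → V) (ℓ q : ℕ) (P : Set V)
    (n : ℕ) (f : ℕ → V) : Prop where
  mem : ∀ v, v ∈ P ↔ ∃ i < n, f i = v
  inj : ∀ i j, i < n → j < n → f i = f j → i = j
  adj : ∀ i j, i < n → j < n → (G.Adj (f i) (f j) ↔ i + 1 = j ∨ j + 1 = i)
  dom : ∀ s, ∃ i < n, G.Adj (σ s) (f i)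
  ends : ∀ i s, i < n → G.Adj (σ s) (f i) → ℓ + 1 ≤ i ∧ i + ℓ + 1 < n
  ample : ∀ i j s t, i ≤ j → j < n → s ≠ t → G.Adj (σ s) (f i) → G.Adj (σ t) (f j) →
    i + ℓ + 1 ≤ j
  zig : ∀ i j s t, i ≤ j → j < n → s ≠ t → G.Adj (σ s) (f i) → G.Adj (σ t) (f j) →
    ∀ Z : Finset (Fin N), (∀ z ∈ Z, (s < z ∧ z < t) ∨ (t < z ∧ z < s)) → q ≤ Z.card →
      ∃ z ∈ Z, ∃ p, i ≤ p ∧ p ≤ j ∧ G.Adj (σ z) (f p)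

lemma PD.rev {V : Type} {N : ℕ} {G : SimpleGraph V} {σ : Fin N → V} {ℓ q : ℕ} {P : Set V}
    {n : ℕ} {f : ℕ → V} (h : PD G σ ℓ q P n f) :
    PD G σ ℓ q P n (fun i => f (n - 1 - i)) where
  mem v := by
    rw [h.mem]
    constructor
    · rintro ⟨i, hi, rfl⟩
      exact ⟨n - 1 - i, by omega, by congr 1; omega⟩
    · rintro ⟨i, hi, rfl⟩
      exact ⟨n - 1 - i, by omega, rfl⟩
  inj i j hi hj e := by
    have := h.inj _ _ (by omega) (by omega) e
    omega
  adj i j hi hj := by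
    rw [h.adj _ _ (by omega) (by omega)]
    omega
  dom s := by
    obtain ⟨i, hi, ha⟩ := h.dom s
    refine ⟨n - 1 - i, by omega, ?_⟩
    have : n - 1 - (n - 1 - i) = i := by omega
    simpa [this] using ha
  ends i s hi ha := by
    have := h.ends _ _ (by omega) ha
    omega
  ample i j s t hij hj hst ha hb := by
    have := h.ample (n - 1 - j) (n - 1 - i) t s (by omega) (by omega) hst.symm hb ha
    omega
  zig i j s t hij hj hst ha hb Z hZ hc := by
    obtain ⟨z, hz, p, h1, h2, h3⟩ := h.zig (n - 1 - j) (n - 1 - i) t s (by omega) (by omega)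
      hst.symm hb ha Z (fun z hz => (hZ z hz).symm) hc
    refine ⟨z, hz, n - 1 - p, by omega, by omega, ?_⟩
    have : n - 1 - (n - 1 - p) = p := by omega
    simpa [this] using h3

/-- walk along a sequence -/
lemma exists_walk {V : Type} {G : SimpleGraph V} (f : ℕ → V) (i k : ℕ)
    (hadj : ∀ p, i ≤ p → p < i + k → G.Adj (f p) (f (p + 1)))
    (hinj : ∀ p p', i ≤ p → p ≤ i + k → i ≤ p' → p' ≤ i + k → f p = f p' → p = p') :
    ∃ w : G.Walk (f i) (f (i + k)), w.length = k ∧ w.IsPath ∧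
      ∀ v, v ∈ w.support ↔ ∃ p, i ≤ p ∧ p ≤ i + k ∧ f p = v := by
  induction k with
  | zero =>
    refine ⟨Walk.nil, rfl, by simp, fun v => ?_⟩
    simp only [Walk.support_nil, List.mem_singleton]
    constructor
    · rintro rfl; exact ⟨i, le_rfl, by omega, rfl⟩
    · rintro ⟨p, h1, h2, rfl⟩
      have : p = i := by omega
      rw [this]
  | succ k ih =>
    obtain ⟨w, h1, h2, h3⟩ := ih (fun p a b => hadj p a (by omega))
      (fun p p' a b c d => hinj p p' a (by omega) c (by omega))
    have ha := hadj (i + k) (by omega) (by omega)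
    refine ⟨w.concat ha, by simp [h1], ?_, fun v => ?_⟩
    · refine (Walk.concat_isPath_iff _).2 ⟨h2, ?_⟩
      rw [h3]
      rintro ⟨p, a, b, c⟩
      have := hinj p (i + k + 1) a (by omega) (by omega) (by omega) c
      omega
    · rw [Walk.support_concat]
      simp only [List.concat_eq_append, List.mem_append, List.mem_singleton, h3]
      constructor
      · rintro (⟨p, a, b, c⟩ | rfl)
        · exact ⟨p, a, by omega, c⟩
        · exact ⟨i + k + 1, by omega, by omega, rfl⟩
      · rintro ⟨p, a, b, c⟩
        by_cases hp : p ≤ i + k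
        · exact Or.inl ⟨p, a, hp, c⟩
        · have : p = i + k + 1 := by omega
          subst this
          exact Or.inr c.symm

lemma exists_enum {V : Type} (S : Set V) (r : V → V → Prop) (N : ℕ) (hf : S.Finite)
    (hN : S.ncard = N) (hr : StrictTotalOrderOn S r) :
    ∃ σ : Fin N → V, Function.Injective σ ∧ (∀ i, σ i ∈ S) ∧ ∀ i j, i < j → r (σ i) (σ j) := by
  classical
  have : Fintype S := hf.fintype
  obtain ⟨h1, h2, h3⟩ := hr
  let r' : S → S → Prop := fun a b => r a b
  have : IsStrictTotalOrder S r' :=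
    { irrefl := fun a => h1 a a.2
      trans := fun a b c => h2 a a.2 b b.2 c c.2
      trichotomous := fun a b hab hba => by
        by_contra hne
        rcases h3 a a.2 b b.2 (fun e => hne (Subtype.ext e)) with h | h
        · exact hab h
        · exact hba h }
  let := linearOrderOfSTO r'
  have hc : Fintype.card S = N := by
    rw [← hN, Set.ncard_eq_toFinset_card', Set.toFinset_card]
  let e := Fintype.orderIsoFinOfCardEq S hc
  refine ⟨fun i => (e i : V), fun i j h => e.injective (Subtype.ext h), fun i => (e i).2, ?_⟩
  intro i j hij
  exact e.strictMono hij

lemma exists_PD {V : Type} {N : ℕ} {G : SimpleGraph V} {S : Set V} {L : Set (Set V)} {ℓ q : ℕ}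
    {r : V → V → Prop} (hC : IsConstellation G S L) (hf : S.Finite)
    (hz : ∀ x ∈ S, ∀ y ∈ S, ∀ p : G.Walk x y, IsRoute G S x y p →
      {z | z ∈ S ∧ ((r x z ∧ r z y) ∨ (r y z ∧ r z x)) ∧
        ∀ v ∈ p.support, ¬ G.Adj z v}.ncard < q)
    (hA : IsAmpleStrong G S L (ℓ + 1))
    {σ : Fin N → V} (hi : Function.Injective σ) (hS : ∀ i, σ i ∈ S)
    (hr : ∀ i j, i < j → r (σ i) (σ j)) (P : Set V) (hP : P ∈ L) :
    ∃ n f, PD G σ ℓ q P n f := by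
  classical
  obtain ⟨n, ⟨e⟩⟩ := hC.pathsArePaths P hP
  obtain ⟨v0, hv0⟩ := hC.pathsNonempty P hP
  let f : ℕ → V := fun i => if h : i < n then (e.symm ⟨i, h⟩ : V) else v0
  have fdef : ∀ i (h : i < n), f i = (e.symm ⟨i, h⟩ : V) := fun i h => by simp [f, h]
  have fP : ∀ i, i < n → f i ∈ P := fun i h => by rw [fdef i h]; exact (e.symm ⟨i, h⟩).2
  have fmem : ∀ v, v ∈ P ↔ ∃ i < n, f i = v := by
    intro v
    constructor
    · intro hv
      refine ⟨(e ⟨v, hv⟩ : Fin n), (e ⟨v, hv⟩).2, ?_⟩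
      rw [fdef _ (e ⟨v, hv⟩).2]; simp
    · rintro ⟨i, h, rfl⟩; exact fP i h
  have finj : ∀ i j, i < n → j < n → f i = f j → i = j := by
    intro i j h h' he
    rw [fdef i h, fdef j h'] at he
    have := e.symm.injective (Subtype.ext he)
    simpa using this
  have fadj : ∀ i j, i < n → j < n → (G.Adj (f i) (f j) ↔ i + 1 = j ∨ j + 1 = i) := by
    intro i j h h'
    rw [fdef i h, fdef j h']
    have : G.Adj (e.symm ⟨i, h⟩ : V) (e.symm ⟨j, h'⟩ : V) ↔
      (G.induce P).Adj (e.symm ⟨i, h⟩) (e.symm ⟨j, h'⟩) := by simp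
    rw [this, e.symm.map_adj_iff, pathGraph_adj]
  have fS : ∀ i, i < n → f i ∉ S := fun i h h' =>
    Set.disjoint_left.1 (hC.pathsOffS P hP) (fP i h) h'
  -- routes
  have route : ∀ i k s t, i + k < n → s ≠ t → G.Adj (σ s) (f i) → G.Adj (σ t) (f (i + k)) →
      ∃ w : G.Walk (σ s) (σ t), IsRoute G S (σ s) (σ t) w ∧ w.length = k + 2 ∧
        ∀ v ∈ w.support, v = σ s ∨ v = σ t ∨ ∃ p, i ≤ p ∧ p ≤ i + k ∧ f p = v := by
    intro i k s t hk hst hs ht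
    obtain ⟨w, h1, h2, h3⟩ := exists_walk (G := G) f i k
      (fun p a b => (fadj p (p + 1) (by omega) (by omega)).2 (Or.inl rfl))
      (fun p p' a b c d => finj p p' (by omega) (by omega))
    have hsup : ∀ v, v ∈ (Walk.cons hs (w.concat ht.symm)).support ↔
        v = σ s ∨ v = σ t ∨ ∃ p, i ≤ p ∧ p ≤ i + k ∧ f p = v := by
      intro v
      simp only [Walk.support_cons, Walk.support_concat, List.concat_eq_append, List.mem_cons,
        List.mem_append, List.mem_singleton, h3, List.not_mem_nil, or_false]
      exact or_congr Iff.rfl or_comm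
    have hns : ∀ x : Fin N, σ x ∉ w.support := by
      intro x hx
      obtain ⟨p, a, b, c⟩ := (h3 _).1 hx
      exact fS p (by omega) (c ▸ hS x)
    refine ⟨Walk.cons hs (w.concat ht.symm), ⟨hS s, hS t, ?_, by simp, ?_⟩, by simp [h1], ?_⟩
    · rw [Walk.cons_isPath_iff, Walk.concat_isPath_iff]
      refine ⟨⟨h2, hns t⟩, ?_⟩
      rw [Walk.support_concat]
      simp only [List.concat_eq_append, List.mem_append, List.mem_singleton, not_or]
      exact ⟨hns s, fun h => hst (hi h)⟩
    · intro v hv a b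
      rcases (hsup v).1 hv with h | h | ⟨p, h, h', rfl⟩
      · exact absurd h a
      · exact absurd h b
      · exact fS p (by omega)
    · intro v hv; exact (hsup v).1 hv
  -- distance
  have hdist : ∀ i k (h : i + k < n), ∃ w : (G.induce P).Walk ⟨f i, fP i (by omega)⟩
      ⟨f (i + k), fP _ h⟩, w.length = k := by
    intro i k
    induction k with
    | zero => intro h; exact ⟨Walk.nil, rfl⟩
    | succ k ih =>
      intro h
      obtain ⟨w, hw⟩ := ih (by omega)
      have : (G.induce P).Adj ⟨f (i + k), fP _ (by omega)⟩ ⟨f (i + (k + 1)), fP _ h⟩ := by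
        simp only [comap_adj, Function.Embedding.subtype_apply]
        exact (fadj _ _ (by omega) (by omega)).2 (Or.inl rfl)
      exact ⟨w.concat this, by simp [hw]⟩
  refine ⟨n, f, fmem, finj, fadj, ?_, ?_, ?_, ?_⟩
  · intro s
    obtain ⟨v, hv, ha⟩ := hC.dominates _ (hS s) P hP
    obtain ⟨i, h, rfl⟩ := (fmem v).1 hv
    exact ⟨i, h, ha⟩
  · intro i s h ha
    have hend : ∀ j, j < n → (j = 0 ∨ j + 1 = n) → IsPathEndpoint G P (f j) := by
      intro j hj hj'
      refine ⟨fP j hj, ?_⟩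
      rw [Set.ncard_le_one_iff (by
        refine Set.Finite.subset (Set.toFinite (f '' (Set.Iio n))) ?_
        rintro v ⟨hv, -⟩
        obtain ⟨p, hp, rfl⟩ := (fmem v).1 hv
        exact ⟨p, hp, rfl⟩)]
      rintro a b ⟨h1, h2⟩ ⟨h3, h4⟩
      obtain ⟨p, hp, rfl⟩ := (fmem a).1 h1
      obtain ⟨p', hp', rfl⟩ := (fmem b).1 h3
      rw [fadj _ _ hj hp] at h2
      rw [fadj _ _ hj hp'] at h4
      have : p = p' := by omega
      rw [this]
    have h0 := hA.2 _ (hS s) P hP (f i) (fP i h) ha (f 0) (fP 0 (by omega))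
      (hend 0 (by omega) (Or.inl rfl))
    have h1 := hA.2 _ (hS s) P hP (f i) (fP i h) ha (f (n - 1)) (fP _ (by omega))
      (hend (n - 1) (by omega) (Or.inr (by omega)))
    constructor
    · obtain ⟨w, hw⟩ := hdist 0 i (by omega)
      have h2 := dist_le w
      rw [SimpleGraph.dist_comm, hw] at h2
      simp only [Nat.zero_add] at h2
      omega
    · obtain ⟨w, hw⟩ := hdist i (n - 1 - i) (by omega)
      have h2 := dist_le w
      rw [hw] at h2
      have e1 : i + (n - 1 - i) = n - 1 := by omega
      simp only [e1] at h2
      omega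
  · intro i j s t hij hj hst hs ht
    obtain ⟨k, rfl⟩ := Nat.exists_eq_add_of_le hij
    obtain ⟨w, h1, h2, -⟩ := route i k s t hj hst hs ht
    have := hA.1 _ _ w h1
    omega
  · intro i j s t hij hj hst hs ht Z hZ hc
    obtain ⟨k, rfl⟩ := Nat.exists_eq_add_of_le hij
    obtain ⟨w, h1, h2, h3⟩ := route i k s t hj hst hs ht
    have hlt := hz _ (hS s) _ (hS t) w h1
    by_contra hcon
    push Not at hcon
    refine absurd hlt (not_lt.2 (hc.trans ?_))
    rw [← Finset.card_map ⟨σ, hi⟩, ← Set.ncard_coe_finset]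
    refine Set.ncard_le_ncard ?_ (hf.subset fun z hz => hz.1)
    intro z hz'
    simp only [Finset.coe_map, Function.Embedding.coeFn_mk, Set.mem_image, Finset.mem_coe] at hz'
    obtain ⟨z, hz', rfl⟩ := hz'
    refine ⟨hS z, (hZ z hz').imp (fun h => ⟨hr _ _ h.1, hr _ _ h.2⟩)
      (fun h => ⟨hr _ _ h.1, hr _ _ h.2⟩), ?_⟩
    intro v hv ha
    rcases h3 v hv with rfl | rfl | ⟨p, a, b, rfl⟩
    · exact hC.indep (hS z) (hS s) ha.ne ha
    · exact hC.indep (hS z) (hS t) ha.ne ha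
    · exact hcon z hz' p a b ha

lemma nat_max (p : ℕ → Prop) (n i : ℕ) (hi : p i) (hb : ∀ j, p j → j < n) :
    ∃ j, p j ∧ ∀ j', p j' → j' ≤ j := by
  classical
  refine ⟨Nat.findGreatest p n, Nat.findGreatest_spec (hb i hi).le hi, fun j' h => ?_⟩
  exact Nat.le_findGreatest (hb j' h).le h

lemma nat_min (p : ℕ → Prop) (i : ℕ) (hi : p i) :
    ∃ j, p j ∧ ∀ j', p j' → j ≤ j' := by
  classical
  exact ⟨Nat.find ⟨i, hi⟩, Nat.find_spec ⟨i, hi⟩, fun j' h => Nat.find_min' _ h⟩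

section
variable {V : Type} {N : ℕ} {G : SimpleGraph V} {σ : Fin N → V} {ℓ q : ℕ} {P : Set V}
    {n : ℕ} {f : ℕ → V}

lemma PD.uniq (h : PD G σ ℓ q P n f) {i : ℕ} {s t : Fin N} (hi : i < n)
    (hs : G.Adj (σ s) (f i)) (ht : G.Adj (σ t) (f i)) : s = t := by
  by_contra hne
  have := h.ample i i s t le_rfl hi hne hs ht
  omega

lemma PD.runR (h : PD G σ ℓ q P n f) {i : ℕ} {s : Fin N} (hi : i < n)
    (hs : G.Adj (σ s) (f i)) : ∃ j, i ≤ j ∧ j + ℓ + 1 < n ∧ G.Adj (σ s) (f j) ∧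
      ∀ p t, i ≤ p → p ≤ j + ℓ → G.Adj (σ t) (f p) → t = s ∧ p ≤ j := by
  obtain ⟨j, ⟨h1, h2, h3, h4⟩, h5⟩ := nat_max (fun j => i ≤ j ∧ j < n ∧ G.Adj (σ s) (f j) ∧
    ∀ p t, i ≤ p → p ≤ j → G.Adj (σ t) (f p) → t = s) n i
    ⟨le_rfl, hi, hs, fun p t a b c => by
      have : p = i := by omega
      subst this
      exact h.uniq hi c hs⟩ (fun j hj => hj.2.1)
  have h6 := (h.ends j s h2 h3).2
  have h7 : ∀ p t, i ≤ p → p ≤ j + ℓ → G.Adj (σ t) (f p) → t = s := by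
    intro p t a b c
    by_cases hp : p ≤ j
    · exact h4 p t a hp c
    by_contra hne
    have := h.ample j p s t (by omega) (by omega) (Ne.symm hne) h3 c
    omega
  refine ⟨j, h1, h6, h3, fun p t a b c => ?_⟩
  have h8 := h7 p t a b c
  subst h8
  exact ⟨rfl, h5 p ⟨a, by omega, c, fun p' t' a' b' => h7 p' t' a' (by omega)⟩⟩

lemma PD.runL (h : PD G σ ℓ q P n f) {i : ℕ} {s : Fin N} (hi : i < n)
    (hs : G.Adj (σ s) (f i)) : ∃ j, j ≤ i ∧ ℓ + 1 ≤ j ∧ G.Adj (σ s) (f j) ∧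
      ∀ p t, j ≤ p + ℓ → p ≤ i → G.Adj (σ t) (f p) → t = s ∧ j ≤ p := by
  obtain ⟨e1, e2⟩ := h.ends i s hi hs
  obtain ⟨j, h1, h2, h3, h4⟩ := h.rev.runR (i := n - 1 - i) (s := s) (by omega) (by
    have : n - 1 - (n - 1 - i) = i := by omega
    simpa [this] using hs)
  refine ⟨n - 1 - j, by omega, by omega, h3, fun p t a b c => ?_⟩
  have := h4 (n - 1 - p) t (by omega) (by omega) (by
    have : n - 1 - (n - 1 - p) = p := by omega
    simpa [this] using c)
  exact ⟨this.1, by omega⟩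

/-- configuration on the first path -/
lemma PD.confP (h : PD G σ ℓ q P n f) (hℓ : q < ℓ) {p0 p1 : ℕ} {s0 s1 : Fin N} (h01 : p0 < p1)
    (h1n : p1 < n) (hs0 : G.Adj (σ s0) (f p0)) (hs1 : G.Adj (σ s1) (f p1))
    (hl0 : (s0 : ℕ) ≤ ℓ + 1) (hl1 : 2 * ℓ + 2 * q + 3 ≤ (s1 : ℕ)) :
    ∃ (a k j j' : ℕ) (m u y : Fin N) (𝒜 : Finset (Fin N)),
      a < k ∧ k + ℓ + 1 ≤ j ∧ j ≤ j' ∧ j' + ℓ + 1 < n ∧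
      (m : ℕ) ≤ ℓ + 1 ∧ ℓ + 1 < (u : ℕ) ∧ (u : ℕ) < (y : ℕ) ∧
      G.Adj (σ u) (f k) ∧ G.Adj (σ y) (f j) ∧
      (∀ t, G.Adj (σ t) (f a) → t = m) ∧
      (∀ p t, a < p → p ≤ k → G.Adj (σ t) (f p) → ℓ + 1 < (t : ℕ) ∧ t < y) ∧
      (∀ p t, k < p → p < j → ¬ G.Adj (σ t) (f p)) ∧
      (∀ p t, j ≤ p → p ≤ j' + ℓ → G.Adj (σ t) (f p) → t = y ∧ p ≤ j') ∧
      ℓ + 1 ≤ 𝒜.card ∧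
      (∀ t ∈ 𝒜, ℓ + 1 < (t : ℕ) ∧ t < u ∧ ∃ p, a < p ∧ p < k ∧ G.Adj (σ t) (f p)) := by
  classical
  obtain ⟨j, ⟨hj0, hjn, y, hy, hyt⟩, hjmin⟩ := nat_min (fun j => p0 < j ∧ j < n ∧
    ∃ y, G.Adj (σ y) (f j) ∧ 2 * ℓ + 2 * q + 3 ≤ (y : ℕ)) p1 ⟨h01, h1n, s1, hs1, hl1⟩
  obtain ⟨k, ⟨hkj, u, hu⟩, hkmax⟩ := nat_max (fun k => k < j ∧ ∃ u, G.Adj (σ u) (f k)) j p0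
    ⟨hj0, s0, hs0⟩ (fun k hk => hk.1)
  obtain ⟨a, ⟨hak, m, hm, hml⟩, hamax⟩ := nat_max (fun a => a ≤ k ∧ ∃ m, G.Adj (σ m) (f a) ∧
    (m : ℕ) ≤ ℓ + 1) (k + 1) p0 ⟨hkmax p0 ⟨hj0, s0, hs0⟩, s0, hs0, hl0⟩ (fun k hk => by omega)
  have hp0a : p0 ≤ a := hamax p0 ⟨hkmax p0 ⟨hj0, s0, hs0⟩, s0, hs0, hl0⟩
  have hlow : ∀ p t, p0 < p → p < j → G.Adj (σ t) (f p) → (t : ℕ) < 2 * ℓ + 2 * q + 3 := by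
    intro p t a b c
    by_contra hcon
    have := hjmin p ⟨a, by omega, t, c, by omega⟩
    omega
  have hut : (u : ℕ) < 2 * ℓ + 2 * q + 3 := by
    rcases Nat.lt_or_ge p0 k with hk | hk
    · exact hlow k u hk hkj hu
    · have hk' : k = p0 := by omega
      rw [hk'] at hu
      have := h.uniq (by omega) hu hs0
      subst this; omega
  have huy : u < y := by rw [Fin.lt_def]; omega
  have hgap : (y : ℕ) ≤ u + q := by
    by_contra hcon
    obtain ⟨z, hz, p, c1, c2, c3⟩ := h.zig k j u y hkj.le hjn huy.ne hu hy (Finset.Ioo u y)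
      (fun z hz => Or.inl (by simpa using hz)) (by rw [Fin.card_Ioo]; omega)
    rw [Finset.mem_Ioo] at hz
    have hp1 : p ≠ k := by
      rintro rfl
      have := h.uniq (by omega) hu c3
      exact absurd this hz.1.ne
    have hp2 : p ≠ j := by
      rintro rfl
      have := h.uniq (by omega) hy c3
      exact absurd this hz.2.ne'
    have := hkmax p ⟨by omega, z, c3⟩
    omega
  have hak' : a ≠ k := by
    rintro rfl
    have := h.uniq (by omega) hu hm
    subst this; omega
  obtain ⟨j', g1, g2, g3, g4⟩ := h.runR hjn hy
  have hmu : m < u := by rw [Fin.lt_def]; omega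
  let 𝒜 : Finset (Fin N) := (Finset.univ : Finset (Fin N)).filter
    (fun t => ℓ + 1 < (t : ℕ) ∧ t < u ∧ ∃ p, a < p ∧ p < k ∧ G.Adj (σ t) (f p))
  refine ⟨a, k, j, j', m, u, y, 𝒜, by omega, h.ample k j u y hkj.le hjn huy.ne hu hy, g1, g2,
    hml, by omega, huy, hu, hy, fun t ht => h.uniq (by omega) ht hm, ?_, ?_, g4, ?_, ?_⟩
  · intro p t c1 c2 c3
    constructor
    · by_contra hcon
      have := hamax p ⟨c2, t, c3, by omega⟩
      omega
    · rw [Fin.lt_def]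
      have := hlow p t (by omega) (by omega) c3
      omega
  · intro p t c1 c2 c3
    have := hkmax p ⟨c2, t, c3⟩
    omega
  · by_contra hcon
    let I : Finset (Fin N) := Finset.Ioo ⟨ℓ + 1, by omega⟩ u
    have hI : I.card = u - (ℓ + 1) - 1 := by simp [I, Fin.card_Ioo]
    have hd : q ≤ (I \ 𝒜).card := by
      have := Finset.le_card_sdiff 𝒜 I
      omega
    obtain ⟨z, hz, p, c1, c2, c3⟩ := h.zig a k m u hak (by omega) hmu.ne hm hu (I \ 𝒜)
      (fun z hz => Or.inl (by
        simp only [I, Finset.mem_sdiff, Finset.mem_Ioo] at hz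
        refine ⟨?_, hz.1.2⟩
        have := hz.1.1
        rw [Fin.lt_def] at this ⊢
        simp only at this
        omega)) hd
    simp only [I, Finset.mem_sdiff, Finset.mem_Ioo, 𝒜, Finset.mem_filter, Finset.mem_univ,
      true_and, Fin.lt_def] at hz
    have hp1 : p ≠ a := by
      rintro rfl
      have := h.uniq (by omega) hm c3
      subst this; omega
    have hp2 : p ≠ k := by
      rintro rfl
      have := h.uniq (by omega) hu c3
      subst this; omega
    exact hz.2 ⟨hz.1.1, hz.1.2, p, by omega, by omega, c3⟩
  · intro t ht
    simpa [𝒜] using ht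

/-- configuration on the second path -/
lemma PD.confQ (h : PD G σ ℓ q P n f) (hℓ : q < ℓ) {p0 p1 : ℕ} {s0 s1 m u : Fin N}
    (𝒜 : Finset (Fin N)) (h𝒜 : ℓ + 1 ≤ 𝒜.card) (h𝒜' : ∀ t ∈ 𝒜, ℓ + 1 < (t : ℕ) ∧ t < u)
    (h01 : p0 < p1) (h1n : p1 < n) (hs0 : G.Adj (σ s0) (f p0)) (hs1 : G.Adj (σ s1) (f p1))
    (hl0 : s0 ∈ 𝒜) (hl1 : (s1 : ℕ) ≤ ℓ + 1) (hl1' : s1 ≠ m) :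
    ∃ (i' i j j' : ℕ) (a b : Fin N),
      ℓ + 1 ≤ i' ∧ i' ≤ i ∧ i + ℓ + 1 ≤ j ∧ j ≤ j' ∧ j' + ℓ + 1 < n ∧
      a ∈ 𝒜 ∧ (b : ℕ) ≤ ℓ + 1 ∧ b ≠ m ∧ G.Adj (σ a) (f i) ∧ G.Adj (σ b) (f j) ∧
      (∀ p t, i' ≤ p + ℓ → p ≤ i → G.Adj (σ t) (f p) → t = a ∧ i' ≤ p) ∧
      (∀ p t, i < p → p < j → G.Adj (σ t) (f p) →
        t ∉ 𝒜 ∧ (ℓ + 1 < (t : ℕ) ∨ t = m) ∧ t < u) ∧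
      (∀ p t, j ≤ p → p ≤ j' + ℓ → G.Adj (σ t) (f p) → t = b ∧ p ≤ j') := by
  obtain ⟨j, ⟨hj0, hjn, b, hb, hbl, hbm⟩, hjmin⟩ := nat_min (fun j => p0 < j ∧ j < n ∧
    ∃ b, G.Adj (σ b) (f j) ∧ (b : ℕ) ≤ ℓ + 1 ∧ b ≠ m) p1 ⟨h01, h1n, s1, hs1, hl1, hl1'⟩
  obtain ⟨i, ⟨hij, a, ha, ha𝒜⟩, himax⟩ := nat_max (fun i => i < j ∧ ∃ a, G.Adj (σ a) (f i) ∧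
    a ∈ 𝒜) j p0 ⟨hj0, s0, hs0, hl0⟩ (fun k hk => hk.1)
  have hp0i := himax p0 ⟨hj0, s0, hs0, hl0⟩
  have hab : a ≠ b := by
    rintro rfl
    have := h𝒜' a ha𝒜
    omega
  obtain ⟨j', g1, g2, g3, g4⟩ := h.runR hjn hb
  obtain ⟨i', e1, e2, e3, e4⟩ := h.runL (by omega) ha
  refine ⟨i', i, j, j', a, b, e2, e1, h.ample i j a b hij.le hjn hab ha hb, g1, g2, ha𝒜, hbl,
    hbm, ha, hb, e4, ?_, g4⟩
  intro p t c1 c2 c3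
  have hp : ∀ p', p ≤ p' → p' ≤ j → ∀ t ∈ 𝒜, ¬ G.Adj (σ t) (f p') := by
    intro p' d1 d2 t ht d3
    by_cases hpj : p' = j
    · subst hpj
      have := h.uniq hjn d3 hb
      subst this
      have := h𝒜' _ ht
      omega
    · have := himax p' ⟨by omega, t, d3, ht⟩
      omega
  refine ⟨fun ht => hp p le_rfl c2.le t ht c3, ?_, ?_⟩
  · by_contra hcon
    push Not at hcon
    have := hjmin p ⟨by omega, by omega, t, c3, hcon.1, hcon.2⟩
    omega
  · by_contra hcon
    rw [not_lt] at hcon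
    have htb : t ≠ b := by
      rintro rfl
      obtain ⟨x, hx⟩ := Finset.card_pos.1 (show 0 < 𝒜.card by omega)
      have := h𝒜' x hx
      rw [Fin.lt_def] at this
      rw [Fin.le_def] at hcon
      omega
    obtain ⟨z, hz, p', d1, d2, d3⟩ := h.zig p j t b c2.le hjn htb c3 hb 𝒜 (fun z hz => by
      have := h𝒜' z hz
      right
      rw [Fin.lt_def] at this ⊢
      rw [Fin.le_def] at hcon
      constructor
      · omega
      · rw [Fin.lt_def]; omega) (by omega)
    exact hp p' d1 d2 z hz d3

end

lemma reach_seq {V : Type*} {G : SimpleGraph V} (M : Set V) (f : ℕ → V) (a k : ℕ)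
    (hM : ∀ p, a ≤ p → p ≤ a + k → f p ∈ M)
    (hadj : ∀ p, a ≤ p → p < a + k → G.Adj (f p) (f (p + 1))) :
    (G.induce M).Reachable ⟨f a, hM a le_rfl (by omega)⟩ ⟨f (a + k), hM _ (by omega) le_rfl⟩ := by
  induction k with
  | zero => exact Reachable.refl _
  | succ k ih =>
    refine (ih (fun p a b => hM p a (by omega)) (fun p a b => hadj p a (by omega))).trans ?_
    refine Adj.reachable ?_
    simp only [comap_adj, Function.Embedding.subtype_apply]
    exact hadj (a + k) (by omega) (by omega)

lemma steps_mono (τ : ℕ → ℕ) (lo hi : ℕ)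
    (hs : ∀ p, lo ≤ p → p < hi → τ (p + 1) = τ p ∨ τ (p + 1) = τ p + 1) :
    ∀ p p', lo ≤ p → p ≤ p' → p' ≤ hi → τ p ≤ τ p' := by
  intro p p' h1 h2
  induction p', h2 using Nat.le_induction with
  | base => intro _; exact le_rfl
  | succ k hk ih =>
    intro h3
    have := ih (by omega)
    have := hs k (by omega) (by omega)
    omega

lemma steps_surj (τ : ℕ → ℕ) (lo hi : ℕ) (hlh : lo ≤ hi) (h0 : τ lo = 0)
    (hs : ∀ p, lo ≤ p → p < hi → τ (p + 1) = τ p ∨ τ (p + 1) = τ p + 1) :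
    ∀ i ≤ τ hi, ∃ p, lo ≤ p ∧ p ≤ hi ∧ τ p = i ∧ (p < hi → i < τ hi → ∃ p', lo ≤ p' ∧ p' < hi ∧
      τ p' = i ∧ τ (p' + 1) = i + 1) := by
  induction hi, hlh using Nat.le_induction with
  | base =>
    intro i hi
    exact ⟨lo, le_rfl, le_rfl, by omega, fun h => by omega⟩
  | succ k hk ih =>
    have ih := ih (fun p a b => hs p a (by omega))
    intro i hi
    rcases hs k hk (by omega) with h | h
    · obtain ⟨p, a, b, c, d⟩ := ih i (by omega)
      refine ⟨p, a, by omega, c, fun h1 h2 => ?_⟩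
      by_cases hp : p < k
      · obtain ⟨p', e1, e2, e3⟩ := d hp (by omega)
        exact ⟨p', e1, by omega, e3⟩
      · have : p = k := by omega
        subst this; omega
    · by_cases hi' : i = τ (k + 1)
      · exact ⟨k + 1, by omega, le_rfl, hi'.symm, fun h => by omega⟩
      · obtain ⟨p, a, b, c, d⟩ := ih i (by omega)
        refine ⟨p, a, by omega, c, fun h1 h2 => ?_⟩
        by_cases hik : i = τ k
        · exact ⟨k, hk, by omega, hik.symm, by omega⟩
        · have : p ≠ k := by rintro rfl; omega
          obtain ⟨p', e1, e2, e3⟩ := d (by omega) (by omega)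
          exact ⟨p', e1, by omega, e3⟩

lemma steps_cross (τ : ℕ → ℕ) (lo hi : ℕ) (hlh : lo ≤ hi) (h0 : τ lo = 0)
    (hs : ∀ p, lo ≤ p → p < hi → τ (p + 1) = τ p ∨ τ (p + 1) = τ p + 1) (i : ℕ) (hi' : i < τ hi) :
    ∃ p', lo ≤ p' ∧ p' < hi ∧ τ p' = i ∧ τ (p' + 1) = i + 1 := by
  obtain ⟨p, a, b, c, d⟩ := steps_surj τ lo hi hlh h0 hs i hi'.le
  have : p ≠ hi := by rintro rfl; omega
  exact d (by omega) hi'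

theorem model {V W C D : Type*} (G : SimpleGraph V) (H : SimpleGraph W)
    (f : C → ℕ → V) (lo hi K : C → ℕ) (τ : C → ℕ → ℕ) (w : C → ℕ → W) (σ : D → V) (ω : D → W)
    (hlh : ∀ c, lo c ≤ hi c)
    (finj : ∀ c c' p p', lo c ≤ p → p ≤ hi c → lo c' ≤ p' → p' ≤ hi c' → f c p = f c' p' →
      c = c' ∧ p = p')
    (fadj : ∀ c c' p p', lo c ≤ p → p ≤ hi c → lo c' ≤ p' → p' ≤ hi c' →
      G.Adj (f c p) (f c' p') → c = c' ∧ (p + 1 = p' ∨ p' + 1 = p))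
    (fadj' : ∀ c p, lo c ≤ p → p < hi c → G.Adj (f c p) (f c (p + 1)))
    (σinj : Function.Injective σ)
    (σf : ∀ d c p, lo c ≤ p → p ≤ hi c → σ d ≠ f c p)
    (σind : ∀ d d', ¬ G.Adj (σ d) (σ d'))
    (τ0 : ∀ c, τ c (lo c) = 0) (τ1 : ∀ c, τ c (hi c) = K c)
    (τs : ∀ c p, lo c ≤ p → p < hi c → τ c (p + 1) = τ c p ∨ τ c (p + 1) = τ c p + 1)
    (winj : ∀ c c' i i', i ≤ K c → i' ≤ K c' → w c i = w c' i' → c = c' ∧ i = i')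
    (ωinj : Function.Injective ω)
    (cover : ∀ v, (∃ c i, i ≤ K c ∧ w c i = v) ∨ ∃ d, ω d = v)
    (Hpath : ∀ c i, i < K c → H.Adj (w c i) (w c (i + 1)))
    (Hlab : ∀ d c p, lo c ≤ p → p ≤ hi c → G.Adj (σ d) (f c p) →
      ω d = w c (τ c p) ∨ H.Adj (ω d) (w c (τ c p)))
    (Hedge : ∀ u v, H.Adj u v → ∃ u' v', (u = u' ∧ v = v' ∨ u = v' ∧ v = u') ∧
      ((∃ c i, i < K c ∧ u' = w c i ∧ v' = w c (i + 1)) ∨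
       ∃ d c p, lo c ≤ p ∧ p ≤ hi c ∧ G.Adj (σ d) (f c p) ∧ u' = ω d ∧ v' = w c (τ c p)))
    (Hown : ∀ d c i, i ≤ K c → ω d = w c i →
      ∃ p, lo c ≤ p ∧ p ≤ hi c ∧ τ c p = i ∧ G.Adj (σ d) (f c p)) :
    InducedMinor H G := by
  have mono := fun c => steps_mono (τ c) (lo c) (hi c) (τs c)
  have τK : ∀ c p, lo c ≤ p → p ≤ hi c → τ c p ≤ K c := fun c p a b =>
    τ1 c ▸ mono c p (hi c) a b le_rfl
  let M : W → Set V := fun v => {x | (∃ c p, lo c ≤ p ∧ p ≤ hi c ∧ w c (τ c p) = v ∧ x = f c p) ∨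
    ∃ d, ω d = v ∧ x = σ d}
  have memf : ∀ c p, lo c ≤ p → p ≤ hi c → f c p ∈ M (w c (τ c p)) := fun c p a b =>
    Or.inl ⟨c, p, a, b, rfl, rfl⟩
  have memσ : ∀ d, σ d ∈ M (ω d) := fun d => Or.inr ⟨d, rfl, rfl⟩
  have conn : ∀ c p p', lo c ≤ p → p ≤ p' → p' ≤ hi c → (v : W) → w c (τ c p) = v →
      w c (τ c p') = v → ∀ (h1 : f c p ∈ M v) (h2 : f c p' ∈ M v),
      (G.induce (M v)).Reachable ⟨f c p, h1⟩ ⟨f c p', h2⟩ := by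
    intro c p p' a b e v hv hv' h1 h2
    obtain ⟨k, rfl⟩ := Nat.exists_eq_add_of_le b
    have hMem : ∀ t, p ≤ t → t ≤ p + k → f c t ∈ M v := ?_
    · exact reach_seq (M v) (f c) p k hMem (fun t ht ht' => fadj' c t (by omega) (by omega))
    intro t ht ht'
    have := (winj c c _ _ (τK c p a (by omega)) (τK c (p + k) (by omega) e) (hv.trans hv'.symm)).2
    have h3 := mono c p t a ht (by omega)
    have h4 := mono c t (p + k) (by omega) ht' e
    have h5 : τ c t = τ c p := by omega
    rw [← hv, ← h5]
    exact memf c t (by omega) (by omega)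
  have conn' : ∀ c p p', lo c ≤ p → p ≤ hi c → lo c ≤ p' → p' ≤ hi c → (v : W) →
      w c (τ c p) = v →
      w c (τ c p') = v → ∀ (h1 : f c p ∈ M v) (h2 : f c p' ∈ M v),
      (G.induce (M v)).Reachable ⟨f c p, h1⟩ ⟨f c p', h2⟩ := by
    intro c p p' a b a' b' v hv hv' h1 h2
    rcases le_total p p' with h | h
    · exact conn c p p' a h b' v hv hv' h1 h2
    · exact (conn c p' p a' h b v hv' hv h2 h1).symm
  have hne : ∀ v, (M v).Nonempty := by
    intro v
    rcases cover v with ⟨c, i, h, rfl⟩ | ⟨d, rfl⟩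
    · obtain ⟨p, a, b, e, -⟩ := steps_surj (τ c) (lo c) (hi c) (hlh c) (τ0 c) (τs c) i
        (by rw [τ1]; exact h)
      exact ⟨f c p, e ▸ memf c p a b⟩
    · exact ⟨_, memσ d⟩
  have key : ∀ v (x y : V) (hx : x ∈ M v) (hy : y ∈ M v),
      (G.induce (M v)).Reachable ⟨x, hx⟩ ⟨y, hy⟩ := by
    have mixed : ∀ v d c p (hd : ω d = v) (a : lo c ≤ p) (b : p ≤ hi c) (hw : w c (τ c p) = v)
        (h1 : σ d ∈ M v) (h2 : f c p ∈ M v),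
        (G.induce (M v)).Reachable ⟨σ d, h1⟩ ⟨f c p, h2⟩ := by
      intro v d c p hd a b hw h1 h2
      obtain ⟨p', a', b', e', g⟩ := Hown d c (τ c p) (τK c p a b) (hd.trans hw.symm)
      have hw' : w c (τ c p') = v := by rw [e']; exact hw
      have h3 : f c p' ∈ M v := hw' ▸ memf c p' a' b'
      refine Reachable.trans (v := ⟨f c p', h3⟩) (Adj.reachable ?_)
        (conn' c p' p a' b' a b v hw' hw h3 h2)
      simpa using g
    intro v x y hx hy
    have hx' := hx
    have hy' := hy
    rcases hx' with ⟨c, p, a, b, e, rfl⟩ | ⟨d, hd, rfl⟩ <;>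
    rcases hy' with ⟨c', p', a', b', e', rfl⟩ | ⟨d', hd', rfl⟩
    · have := (winj c c' _ _ (τK c p a b) (τK c' p' a' b') (e.trans e'.symm)).1
      subst this
      exact conn' c p p' a b a' b' v e e' hx hy
    · exact (mixed v d' c p hd' a b e hy hx).symm
    · exact mixed v d c' p' hd a' b' e' hx hy
    · have := ωinj (hd.trans hd'.symm)
      subst this
      exact Reachable.refl _
  refine ⟨M, hne, ?_, ?_, ?_⟩
  · intro v
    have : Nonempty (M v) := (hne v).to_subtype
    exact ⟨fun x y => key v x.1 y.1 x.2 y.2⟩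
  · intro u v huv
    rw [Set.disjoint_left]
    rintro x (⟨c, p, a, b, e, rfl⟩ | ⟨d, hd, rfl⟩) (⟨c', p', a', b', e', h⟩ | ⟨d', hd', h⟩)
    · obtain ⟨rfl, rfl⟩ := finj c c' p p' a b a' b' h
      exact huv (e.symm.trans e')
    · exact σf d' c p a b h.symm
    · exact σf d c' p' a' b' h
    · have := σinj h
      subst this
      exact huv (hd.symm.trans hd')
  · intro u v huv
    constructor
    · rintro ⟨x, hx, y, hy, hxy⟩
      rcases hx with ⟨c, p, a, b, e, rfl⟩ | ⟨d, hd, rfl⟩ <;>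
      rcases hy with ⟨c', p', a', b', e', rfl⟩ | ⟨d', hd', rfl⟩
      · obtain ⟨rfl, h⟩ := fadj c c' p p' a b a' b' hxy
        subst e e'
        rcases h with rfl | rfl
        · rcases τs c p a (by omega) with h | h
          · rw [h] at huv; exact absurd rfl huv
          · have := τK c (p + 1) a' b'
            rw [h]; exact Hpath c _ (by omega)
        · rcases τs c p' a' (by omega) with h | h
          · rw [h] at huv; exact absurd rfl huv
          · have := τK c (p' + 1) a b
            rw [h]; exact (Hpath c _ (by omega)).symm
      · subst e hd'
        rcases Hlab d' c p a b hxy.symm with h | h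
        · exact absurd h.symm huv
        · exact h.symm
      · subst hd e'
        rcases Hlab d c' p' a' b' hxy with h | h
        · exact absurd h huv
        · exact h
      · exact absurd hxy (σind d d')
    · intro hA
      obtain ⟨u', v', huv', hR⟩ := Hedge u v hA
      have : ∃ a ∈ M u', ∃ b ∈ M v', G.Adj a b := by
        rcases hR with ⟨c, i, hi', rfl, rfl⟩ | ⟨d, c, p, a, b, e, rfl, rfl⟩
        · obtain ⟨p, a, b, e1, e2⟩ := steps_cross (τ c) (lo c) (hi c) (hlh c) (τ0 c) (τs c) i
            (by rw [τ1]; exact hi')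
          exact ⟨f c p, e1 ▸ memf c p a (by omega), f c (p + 1),
            e2 ▸ memf c (p + 1) (by omega) (by omega), fadj' c p a b⟩
        · exact ⟨σ d, memσ d, f c p, memf c p a b, e⟩
      obtain ⟨a, ha, b, hb, hab⟩ := this
      rcases huv' with ⟨rfl, rfl⟩ | ⟨rfl, rfl⟩
      · exact ⟨a, ha, b, hb, hab⟩
      · exact ⟨b, hb, a, ha, hab.symm⟩

abbrev tRoot (ℓ : ℕ) : TVert ℓ := Sum.inl ()
abbrev tLeaf {ℓ : ℕ} (i : Fin ℓ) : TVert ℓ := Sum.inr (Sum.inl i)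
abbrev tLeg {ℓ : ℕ} (b : Fin 2) (i : Fin (ℓ + 2)) : TVert ℓ := Sum.inr (Sum.inr (Sum.inl (b, i)))
abbrev tPend {ℓ : ℕ} (b : Fin 3) (i : Fin ℓ) : TVert ℓ :=
  Sum.inr (Sum.inr (Sum.inr (Sum.inl (b, i))))
abbrev tGlu {ℓ : ℕ} (k : Fin (ℓ + 3)) (p : Fin ℓ) (i : Fin (2 * ℓ + 1)) : TVert ℓ :=
  Sum.inr (Sum.inr (Sum.inr (Sum.inr (k, p, i))))

inductive TC (ℓ : ℕ) (three : Bool) : TVert ℓ → TVert ℓ → Prop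
  | leaf (i) : TC ℓ three (tRoot ℓ) (tLeaf i)
  | child (b) : TC ℓ three (tRoot ℓ) (tLeg b ⟨0, by omega⟩)
  | leg (b) (i : ℕ) (h : i + 1 < ℓ + 2) : TC ℓ three (tLeg b ⟨i, by omega⟩) (tLeg b ⟨i + 1, h⟩)
  | pend (b) (i : ℕ) (h : i + 1 < ℓ) : TC ℓ three (tPend b ⟨i, by omega⟩) (tPend b ⟨i + 1, h⟩)
  | att (p) (h : 0 < ℓ) : TC ℓ three (attachPt ℓ three p) (tPend p ⟨0, h⟩)

inductive TGl (ℓ : ℕ) : TVert ℓ → TVert ℓ → Prop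
  | glu (k p) (i : ℕ) (h : i + 1 < 2 * ℓ + 1) : TGl ℓ (tGlu k p ⟨i, by omega⟩) (tGlu k p ⟨i + 1, h⟩)
  | site (k p) : TGl ℓ (glueSite ℓ k) (tGlu k p ⟨ℓ, by omega⟩)

lemma attachPt_form (ℓ : ℕ) (three : Bool) (p : Fin 3) : ∃ b i, attachPt ℓ three p = tLeg b i := by
  unfold attachPt
  split_ifs <;> exact ⟨_, _, rfl⟩

lemma glueSite_form (ℓ : ℕ) (k : Fin (ℓ + 3)) :
    (∃ i, glueSite ℓ k = tLeaf i) ∨ ∃ b i, glueSite ℓ k = tLeg b i := by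
  unfold glueSite
  split_ifs
  · exact Or.inl ⟨_, rfl⟩
  all_goals exact Or.inr ⟨_, _, rfl⟩

lemma glueSite_inj (ℓ : ℕ) : Function.Injective (glueSite ℓ) := by
  intro k k' h
  have := k.2
  have := k'.2
  unfold glueSite at h
  split_ifs at h <;> simp at h <;> apply Fin.ext <;> omega

lemma TAdj_of_TC {ℓ three u v} (h : TC ℓ three u v) : TAdj ℓ three u v := by
  cases h with
  | att p h =>
    obtain ⟨b, i, e⟩ := attachPt_form ℓ three p
    rw [e]
    exact ⟨rfl, e.symm⟩
  | _ => simp [TAdj]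

lemma TAdj_of_TGl {ℓ three u v} (h : TGl ℓ u v) : TAdj ℓ three u v := by
  cases h with
  | site k p =>
    rcases glueSite_form ℓ k with ⟨i, e⟩ | ⟨b, i, e⟩ <;> rw [e] <;> exact ⟨rfl, e.symm⟩
  | _ => simp [TAdj]

lemma TAdj_inv {ℓ three u v} (h : TAdj ℓ three u v) : TC ℓ three u v ∨ TGl ℓ u v := by
  rcases u with ⟨⟩ | u | ⟨b, u⟩ | ⟨b, u⟩ | ⟨k, p, u⟩ <;>
  rcases v with ⟨⟩ | v | ⟨b', v⟩ | ⟨b', v⟩ | ⟨k', p', v⟩ <;>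
  try exact h.elim
  · exact Or.inl (TC.leaf _)
  · obtain ⟨v, hv⟩ := v
    have : v = 0 := h
    subst this
    exact Or.inl (TC.child _)
  all_goals
    first
    | (obtain ⟨v, hv⟩ := v
       obtain ⟨u, hu⟩ := u
       obtain ⟨h1, h2⟩ := h
       simp only at h1 h2
       subst h1 h2
       first
       | exact Or.inl (TC.leg _ _ _)
       | exact Or.inl (TC.pend _ _ _))
    | (obtain ⟨v, hv⟩ := v
       obtain ⟨u, hu⟩ := u
       obtain ⟨h1, h2, h3⟩ := h
       simp only at h1 h2 h3
       subst h1 h2 h3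
       exact Or.inr (TGl.glu _ _ _ _))
    | (obtain ⟨v, hv⟩ := v
       obtain ⟨h1, h2⟩ := h
       simp only at h1 h2
       subst h1
       rw [h2]
       first
       | exact Or.inl (TC.att _ _)
       | exact Or.inr (TGl.site _ _))

lemma TAdj_irrefl {ℓ three u} : ¬ TAdj ℓ three u u := by
  rcases u with ⟨⟩ | u | ⟨b, u⟩ | ⟨b, u⟩ | ⟨k, p, u⟩ <;> simp [TAdj]

def TT (ℓ : ℕ) (three : Bool) : SimpleGraph (TVert ℓ) := SimpleGraph.fromRel (TAdj ℓ three)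

def TG (ℓ : ℕ) (three : Bool) :
    SimpleGraph (TVert ℓ ⊕ Fin ℓ × (Unit ⊕ Fin ℓ × Fin (2 * ℓ + 1))) :=
  disjUnion (TT ℓ three) (copies ℓ (T1Graph ℓ))

lemma TT_adj {ℓ three u v} : (TT ℓ three).Adj u v ↔ TAdj ℓ three u v ∨ TAdj ℓ three v u := by
  unfold TT
  rw [fromRel_adj]
  constructor
  · exact fun h => h.2
  · intro h
    refine ⟨?_, h⟩
    rintro rfl
    exact TAdj_irrefl (h.elim id id)

lemma TC.adj {ℓ three u v} (h : TC ℓ three u v) : (TT ℓ three).Adj u v :=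
  TT_adj.2 (Or.inl (TAdj_of_TC h))

lemma TG_inl {ℓ three u v} : (TG ℓ three).Adj (Sum.inl u) (Sum.inl v) ↔ (TT ℓ three).Adj u v := by
  unfold TG disjUnion
  rw [fromRel_adj]
  simp only [ne_eq, Sum.inl.injEq, adj_comm _ v u, or_self]
  exact ⟨fun h => h.2, fun h => ⟨h.ne, h⟩⟩

inductive T1E (ℓ : ℕ) : Unit ⊕ Fin ℓ × Fin (2 * ℓ + 1) → Unit ⊕ Fin ℓ × Fin (2 * ℓ + 1) → Prop
  | glu (p) (i : ℕ) (h : i + 1 < 2 * ℓ + 1) :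
      T1E ℓ (Sum.inr (p, ⟨i, by omega⟩)) (Sum.inr (p, ⟨i + 1, h⟩))
  | site (p) : T1E ℓ (Sum.inl ()) (Sum.inr (p, ⟨ℓ, by omega⟩))

lemma TG_inr {ℓ three z u v} (h : T1E ℓ u v) :
    (TG ℓ three).Adj (Sum.inr (z, u)) (Sum.inr (z, v)) := by
  cases h <;> simp [TG, disjUnion, copies, T1Graph]

lemma TG_inv {ℓ three} {u v} (h : (TG ℓ three).Adj u v) : ∃ u' v',
    (u = u' ∧ v = v' ∨ u = v' ∧ v = u') ∧ ((∃ a b, u' = Sum.inl a ∧ v' = Sum.inl b ∧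
      (TC ℓ three a b ∨ TGl ℓ a b)) ∨ ∃ z a b, u' = Sum.inr (z, a) ∧ v' = Sum.inr (z, b) ∧
      T1E ℓ a b) := by
  have T1 : ∀ a b : Unit ⊕ Fin ℓ × Fin (2 * ℓ + 1), (T1Graph ℓ).Adj a b → T1E ℓ a b ∨ T1E ℓ b a := by
    intro a b h
    unfold T1Graph at h
    rw [fromRel_adj] at h
    rcases a with ⟨⟩ | ⟨p, i, hi⟩ <;> rcases b with ⟨⟩ | ⟨p', i', hi'⟩ <;>
      simp only [ne_eq, or_false, false_or, and_false] at h
    · obtain ⟨-, rfl⟩ := h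
      exact Or.inl (T1E.site _)
    · obtain ⟨-, rfl⟩ := h
      exact Or.inr (T1E.site _)
    · obtain ⟨-, ⟨rfl, rfl⟩ | ⟨rfl, rfl⟩⟩ := h
      · exact Or.inl (T1E.glu _ _ _)
      · exact Or.inr (T1E.glu _ _ _)
  rcases u with u | ⟨z, u⟩ <;> rcases v with v | ⟨z', v⟩
  · rw [TG_inl, TT_adj] at h
    rcases h with h | h
    · exact ⟨_, _, Or.inl ⟨rfl, rfl⟩, Or.inl ⟨_, _, rfl, rfl, TAdj_inv h⟩⟩
    · exact ⟨_, _, Or.inr ⟨rfl, rfl⟩, Or.inl ⟨_, _, rfl, rfl, TAdj_inv h⟩⟩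
  · simp [TG, disjUnion] at h
  · simp [TG, disjUnion] at h
  · have : z = z' ∧ (T1Graph ℓ).Adj u v := by
      simp only [TG, disjUnion, copies, fromRel_adj] at h
      obtain ⟨-, ⟨-, h⟩ | ⟨-, h⟩⟩ := h
      · rcases h with h | h
        · exact h
        · exact ⟨h.1.symm, h.2.symm⟩
      · rcases h with h | h
        · exact ⟨h.1.symm, h.2.symm⟩
        · exact h
    obtain ⟨rfl, h'⟩ := this
    rcases T1 _ _ h' with h | h
    · exact ⟨_, _, Or.inl ⟨rfl, rfl⟩, Or.inr ⟨_, _, _, rfl, rfl, h⟩⟩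
    · exact ⟨_, _, Or.inr ⟨rfl, rfl⟩, Or.inr ⟨_, _, _, rfl, rfl, h⟩⟩

abbrev PIdx (ℓ : ℕ) : Type := Bool ⊕ (Fin (ℓ + 3) ⊕ Fin ℓ) × Fin ℓ

def omg (ℓ : ℕ) (E : Type) : (Fin (ℓ + 3) ⊕ Fin ℓ) ⊕ E →
    TVert ℓ ⊕ Fin ℓ × (Unit ⊕ Fin ℓ × Fin (2 * ℓ + 1))
  | Sum.inl (Sum.inl k) => Sum.inl (glueSite ℓ k)
  | Sum.inl (Sum.inr z) => Sum.inr (z, Sum.inl ())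
  | Sum.inr _ => Sum.inl (tRoot ℓ)

def wAll (ℓ : ℕ) (w : Bool → ℕ → TVert ℓ) : PIdx ℓ → ℕ →
    TVert ℓ ⊕ Fin ℓ × (Unit ⊕ Fin ℓ × Fin (2 * ℓ + 1))
  | Sum.inl b, i => Sum.inl (w b i)
  | Sum.inr (Sum.inl k, p), i => Sum.inl (tGlu k p ⟨min i (2 * ℓ), by omega⟩)
  | Sum.inr (Sum.inr z, p), i => Sum.inr (z, Sum.inr (p, ⟨min i (2 * ℓ), by omega⟩))

lemma glueSite_ne_root {ℓ k} : glueSite ℓ k ≠ tRoot ℓ := by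
  rcases glueSite_form ℓ k with ⟨i, e⟩ | ⟨b, i, e⟩ <;> rw [e] <;> simp

lemma glueSite_ne_glu {ℓ k k' p i} : glueSite ℓ k ≠ tGlu k' p i := by
  rcases glueSite_form ℓ k with ⟨i, e⟩ | ⟨b, i, e⟩ <;> rw [e] <;> simp

theorem assemble {V : Type} {N ℓ q : ℕ} (three : Bool) (G : SimpleGraph V) (σ : Fin N → V)
    (E : Type) [Subsingleton E] (PP : PIdx ℓ → Set V) (n : PIdx ℓ → ℕ) (f : PIdx ℓ → ℕ → V)
    (hPD : ∀ c, PD G σ ℓ q (PP c) (n c) (f c))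
    (hcross : ∀ c c', c ≠ c' → ∀ u ∈ PP c, ∀ v ∈ PP c', u ≠ v ∧ ¬ G.Adj u v)
    (σinj : Function.Injective σ) (σind : ∀ s t, ¬ G.Adj (σ s) (σ t))
    (σP : ∀ s c, σ s ∉ PP c)
    (lam : (Fin (ℓ + 3) ⊕ Fin ℓ) ⊕ E → Fin N) (laminj : Function.Injective lam)
    (lo hi K : Bool → ℕ) (τ : Bool → ℕ → ℕ) (w : Bool → ℕ → TVert ℓ)
    (hlh : ∀ b, lo b ≤ hi b) (hhi : ∀ b, hi b < n (Sum.inl b))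
    (τ0 : ∀ c, τ c (lo c) = 0) (τ1 : ∀ c, τ c (hi c) = K c)
    (τs : ∀ c p, lo c ≤ p → p < hi c → τ c (p + 1) = τ c p ∨ τ c (p + 1) = τ c p + 1)
    (winj : ∀ c c' i i', i ≤ K c → i' ≤ K c' → w c i = w c' i' → c = c' ∧ i = i')
    (wng : ∀ b i k p x, w b i ≠ tGlu k p x)
    (cover : ∀ v : TVert ℓ, (∀ k p x, v ≠ tGlu k p x) →
      (∃ b i, i ≤ K b ∧ w b i = v) ∨ ∃ k, glueSite ℓ k = v)
    (Hpath : ∀ c i, i < K c → (TT ℓ three).Adj (w c i) (w c (i + 1)))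
    (Hlab1 : ∀ k b p, lo b ≤ p → p ≤ hi b →
      G.Adj (σ (lam (Sum.inl (Sum.inl k)))) (f (Sum.inl b) p) →
      glueSite ℓ k = w b (τ b p) ∨ (TT ℓ three).Adj (glueSite ℓ k) (w b (τ b p)))
    (Hlab2 : ∀ z b p, lo b ≤ p → p ≤ hi b →
      ¬ G.Adj (σ (lam (Sum.inl (Sum.inr z)))) (f (Sum.inl b) p))
    (Hlab3 : ∀ e b p, lo b ≤ p → p ≤ hi b → G.Adj (σ (lam (Sum.inr e))) (f (Sum.inl b) p) →
      tRoot ℓ = w b (τ b p) ∨ (TT ℓ three).Adj (tRoot ℓ) (w b (τ b p)))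
    (Hedge : ∀ u v, TC ℓ three u v → ∃ u' v', (u = u' ∧ v = v' ∨ u = v' ∧ v = u') ∧
      ((∃ c i, i < K c ∧ u' = w c i ∧ v' = w c (i + 1)) ∨
       (∃ k c p, lo c ≤ p ∧ p ≤ hi c ∧ G.Adj (σ (lam (Sum.inl (Sum.inl k)))) (f (Sum.inl c) p) ∧
        u' = glueSite ℓ k ∧ v' = w c (τ c p)) ∨
       (∃ e c p, lo c ≤ p ∧ p ≤ hi c ∧ G.Adj (σ (lam (Sum.inr e))) (f (Sum.inl c) p) ∧
        u' = tRoot ℓ ∧ v' = w c (τ c p))))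
    (Hown1 : ∀ k c i, i ≤ K c → glueSite ℓ k = w c i → ∃ p, lo c ≤ p ∧ p ≤ hi c ∧ τ c p = i ∧
      G.Adj (σ (lam (Sum.inl (Sum.inl k)))) (f (Sum.inl c) p))
    (Hown2 : ∀ e c i, i ≤ K c → tRoot ℓ = w c i → ∃ p, lo c ≤ p ∧ p ≤ hi c ∧ τ c p = i ∧
      G.Adj (σ (lam (Sum.inr e))) (f (Sum.inl c) p)) :
    InducedMinor (TG ℓ three) G := by
  have hrun : ∀ x : (Fin (ℓ + 3) ⊕ Fin ℓ) × Fin ℓ, ∃ i j, ℓ + 1 ≤ i ∧ i ≤ j ∧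
      j + ℓ + 1 < n (Sum.inr x) ∧ G.Adj (σ (lam (Sum.inl x.1))) (f (Sum.inr x) i) ∧
      ∀ p t, i ≤ p + ℓ → p ≤ j + ℓ → G.Adj (σ t) (f (Sum.inr x) p) →
        t = lam (Sum.inl x.1) ∧ i ≤ p ∧ p ≤ j := by
    intro x
    obtain ⟨r, hr, ha⟩ := (hPD (Sum.inr x)).dom (lam (Sum.inl x.1))
    obtain ⟨j, a1, a2, a3, a4⟩ := (hPD (Sum.inr x)).runR hr ha
    obtain ⟨i, b1, b2, b3, b4⟩ := (hPD (Sum.inr x)).runL hr ha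
    refine ⟨i, j, b2, by omega, a2, b3, fun p t h1 h2 h3 => ?_⟩
    rcases le_total p r with h | h
    · have := b4 p t h1 h h3
      exact ⟨this.1, this.2, by omega⟩
    · have := a4 p t h h2 h3
      exact ⟨this.1, by omega, this.2⟩
  choose I J hI hIJ hJ hIa hIJu using hrun
  let LO : PIdx ℓ → ℕ := Sum.elim lo (fun x => I x - ℓ)
  let HI : PIdx ℓ → ℕ := Sum.elim hi (fun x => J x + ℓ)
  let KK : PIdx ℓ → ℕ := Sum.elim K (fun _ => 2 * ℓ)
  let TAU : PIdx ℓ → ℕ → ℕ := Sum.elim τ (fun x p =>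
    if p < I x then p - (I x - ℓ) else if p ≤ J x then ℓ else ℓ + (p - J x))
  have hHI : ∀ c, HI c < n c := by
    rintro (b | x)
    · exact hhi b
    · have := hJ x
      simp only [HI, Sum.elim_inr]; omega
  have fin : ∀ c p, p ≤ HI c → f c p ∈ PP c := fun c p h =>
    ((hPD c).mem _).2 ⟨p, lt_of_le_of_lt h (hHI c), rfl⟩
  have hroot : ∀ x p, I x ≤ p + ℓ → p ≤ J x + ℓ → ∀ d, G.Adj (σ (lam d)) (f (Sum.inr x) p) →
      d = Sum.inl x.1 ∧ TAU (Sum.inr x) p = ℓ := by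
    intro x p h1 h2 d h3
    obtain ⟨e1, e2, e3⟩ := hIJu x p _ h1 h2 h3
    refine ⟨laminj e1, ?_⟩
    simp only [TAU, Sum.elim_inr]
    split_ifs <;> omega
  refine model G (TG ℓ three) f LO HI KK TAU (wAll ℓ w) (fun d => σ (lam d)) (omg ℓ E)
    ?_ ?_ ?_ ?_ (σinj.comp laminj) ?_ (fun d d' => σind _ _) ?_ ?_ ?_ ?_ ?_ ?_ ?_ ?_ ?_ ?_
  · rintro (b | x)
    · exact hlh b
    · have := hIJ x
      simp only [LO, HI, Sum.elim_inr]; omega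
  · intro c c' p p' a b a' b' e
    by_cases hc : c = c'
    · subst hc
      exact ⟨rfl, (hPD c).inj p p' (lt_of_le_of_lt b (hHI c)) (lt_of_le_of_lt b' (hHI c)) e⟩
    · exact absurd e (hcross c c' hc _ (fin c p b) _ (fin c' p' b')).1
  · intro c c' p p' a b a' b' e
    by_cases hc : c = c'
    · subst hc
      exact ⟨rfl, ((hPD c).adj p p' (lt_of_le_of_lt b (hHI c)) (lt_of_le_of_lt b' (hHI c))).1 e⟩
    · exact absurd e (hcross c c' hc _ (fin c p b) _ (fin c' p' b')).2
  · intro c p a b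
    have := hHI c
    exact ((hPD c).adj p (p + 1) (by omega) (by omega)).2 (Or.inl rfl)
  · intro d c p a b e
    exact σP (lam d) c (e ▸ fin c p b)
  · rintro (b | x)
    · exact τ0 b
    · have := hI x
      have := hIJ x
      simp only [LO, TAU, Sum.elim_inr]
      split_ifs <;> omega
  · rintro (b | x)
    · exact τ1 b
    · have := hIJ x
      simp only [HI, TAU, KK, Sum.elim_inr]
      split_ifs <;> omega
  · rintro (b | x) p h1 h2
    · exact τs b p h1 h2
    · have := hI x
      have := hIJ x
      simp only [LO, HI, TAU, Sum.elim_inr] at h1 h2 ⊢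
      split_ifs <;> omega
  · rintro (b | ⟨k | z, x⟩) (b' | ⟨k' | z', x'⟩) i i' h1 h2 h3 <;>
      simp only [wAll, KK, Sum.elim_inl, Sum.elim_inr] at h1 h2 h3
    · have := winj b b' i i' h1 h2 (Sum.inl_injective h3)
      exact ⟨by rw [this.1], this.2⟩
    · exact absurd (Sum.inl_injective h3) (wng _ _ _ _ _)
    · exact absurd h3 (by simp)
    · exact absurd (Sum.inl_injective h3).symm (wng _ _ _ _ _)
    · simp only [Sum.inl.injEq, Sum.inr.injEq, Prod.mk.injEq, Fin.mk.injEq] at h3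
      obtain ⟨rfl, rfl, h⟩ := h3
      exact ⟨rfl, by omega⟩
    · exact absurd h3 (by simp)
    · exact absurd h3 (by simp)
    · exact absurd h3 (by simp)
    · simp only [Sum.inr.injEq, Prod.mk.injEq, Fin.mk.injEq] at h3
      obtain ⟨rfl, rfl, h⟩ := h3
      exact ⟨rfl, by omega⟩
  · rintro ((k | z) | e) ((k' | z') | e') h <;> simp only [omg] at h
    · rw [glueSite_inj ℓ (Sum.inl_injective h)]
    · exact absurd h (by simp)
    · exact absurd (Sum.inl_injective h) glueSite_ne_root
    · exact absurd h (by simp)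
    · simp only [Sum.inr.injEq, Prod.mk.injEq, and_true] at h
      rw [h]
    · exact absurd h (by simp)
    · exact absurd (Sum.inl_injective h).symm glueSite_ne_root
    · exact absurd h (by simp)
    · rw [Subsingleton.elim e e']
  · rintro (v | ⟨z, ⟨⟩ | ⟨p, i, hi⟩⟩)
    · by_cases hv : ∀ k p x, v ≠ tGlu k p x
      · rcases cover v hv with ⟨b, i, h, rfl⟩ | ⟨k, rfl⟩
        · exact Or.inl ⟨Sum.inl b, i, h, rfl⟩
        · exact Or.inr ⟨Sum.inl (Sum.inl k), rfl⟩
      · push Not at hv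
        obtain ⟨k, p, ⟨i, hi⟩, rfl⟩ := hv
        refine Or.inl ⟨Sum.inr (Sum.inl k, p), i, by simp only [KK, Sum.elim_inr]; omega, ?_⟩
        have : min i (2 * ℓ) = i := by omega
        simp only [wAll, this]
    · exact Or.inr ⟨Sum.inl (Sum.inr z), rfl⟩
    · refine Or.inl ⟨Sum.inr (Sum.inr z, p), i, by simp only [KK, Sum.elim_inr]; omega, ?_⟩
      have : min i (2 * ℓ) = i := by omega
      simp only [wAll, this]
  · rintro (b | ⟨k | z, x⟩) i h <;> simp only [KK, Sum.elim_inl, Sum.elim_inr] at h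
    · exact TG_inl.2 (Hpath b i h)
    · have e1 : min i (2 * ℓ) = i := by omega
      have e2 : min (i + 1) (2 * ℓ) = i + 1 := by omega
      simp only [wAll, e1, e2]
      exact TG_inl.2 (TT_adj.2 (Or.inl (TAdj_of_TGl (TGl.glu k x i (by omega)))))
    · have e1 : min i (2 * ℓ) = i := by omega
      have e2 : min (i + 1) (2 * ℓ) = i + 1 := by omega
      simp only [wAll, e1, e2]
      exact TG_inr (T1E.glu x i (by omega))
  · rintro d (b | x) p h1 h2 h3
    · rcases d with (k | z) | e
      · rcases Hlab1 k b p h1 h2 h3 with h | h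
        · exact Or.inl (congrArg Sum.inl h)
        · exact Or.inr (TG_inl.2 h)
      · exact absurd h3 (Hlab2 z b p h1 h2)
      · rcases Hlab3 e b p h1 h2 h3 with h | h
        · exact Or.inl (congrArg Sum.inl h)
        · exact Or.inr (TG_inl.2 h)
    · simp only [LO, HI, Sum.elim_inr] at h1 h2
      obtain ⟨rfl, e⟩ := hroot x p (by omega) h2 d h3
      right
      rw [e]
      have e1 : min ℓ (2 * ℓ) = ℓ := by omega
      obtain ⟨k | z, x⟩ := x <;> simp only [wAll, omg, e1]
      · exact TG_inl.2 (TT_adj.2 (Or.inl (TAdj_of_TGl (TGl.site k x))))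
      · exact TG_inr (T1E.site x)
  · intro u v huv
    obtain ⟨u', v', hsw, hR⟩ := TG_inv huv
    have hreal : ∀ x : (Fin (ℓ + 3) ⊕ Fin ℓ) × Fin ℓ, LO (Sum.inr x) ≤ I x ∧
        I x ≤ HI (Sum.inr x) ∧ TAU (Sum.inr x) (I x) = ℓ := by
      intro x
      have := hI x
      have := hIJ x
      simp only [LO, HI, TAU, Sum.elim_inr]
      split_ifs <;> omega
    have el : min ℓ (2 * ℓ) = ℓ := by omega
    rcases hR with ⟨a, b, rfl, rfl, h | h⟩ | ⟨z, a, b, rfl, rfl, h⟩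
    · obtain ⟨a', b', hs', h⟩ := Hedge a b h
      refine ⟨Sum.inl a', Sum.inl b', ?_, ?_⟩
      · rcases hsw with ⟨rfl, rfl⟩ | ⟨rfl, rfl⟩ <;> rcases hs' with ⟨rfl, rfl⟩ | ⟨rfl, rfl⟩ <;> simp
      · rcases h with ⟨c, i, h, rfl, rfl⟩ | ⟨k, c, p, h1, h2, h3, rfl, rfl⟩ |
          ⟨e, c, p, h1, h2, h3, rfl, rfl⟩
        · exact Or.inl ⟨Sum.inl c, i, h, rfl, rfl⟩
        · exact Or.inr ⟨Sum.inl (Sum.inl k), Sum.inl c, p, h1, h2, h3, rfl, rfl⟩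
        · exact Or.inr ⟨Sum.inr e, Sum.inl c, p, h1, h2, h3, rfl, rfl⟩
    · refine ⟨_, _, hsw, ?_⟩
      cases h with
      | glu k p i h =>
        left
        have e1 : min i (2 * ℓ) = i := by omega
        have e2 : min (i + 1) (2 * ℓ) = i + 1 := by omega
        refine ⟨Sum.inr (Sum.inl k, p), i, by simp only [KK, Sum.elim_inr]; omega, ?_, ?_⟩ <;>
          simp only [wAll, e1, e2]
      | site k p =>
        right
        obtain ⟨r1, r2, r3⟩ := hreal (Sum.inl k, p)
        refine ⟨Sum.inl (Sum.inl k), Sum.inr (Sum.inl k, p), I (Sum.inl k, p), r1, r2,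
          hIa (Sum.inl k, p), rfl, ?_⟩
        rw [r3]
        simp only [wAll, el]
    · refine ⟨_, _, hsw, ?_⟩
      cases h with
      | glu p i h =>
        left
        have e1 : min i (2 * ℓ) = i := by omega
        have e2 : min (i + 1) (2 * ℓ) = i + 1 := by omega
        refine ⟨Sum.inr (Sum.inr z, p), i, by simp only [KK, Sum.elim_inr]; omega, ?_, ?_⟩ <;>
          simp only [wAll, e1, e2]
      | site p =>
        right
        obtain ⟨r1, r2, r3⟩ := hreal (Sum.inr z, p)
        refine ⟨Sum.inl (Sum.inr z), Sum.inr (Sum.inr z, p), I (Sum.inr z, p), r1, r2,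
          hIa (Sum.inr z, p), rfl, ?_⟩
        rw [r3]
        simp only [wAll, el]
  · rintro d (b | ⟨k' | z', x⟩) i h1 h2
    · rcases d with (k | z) | e <;> simp only [omg, wAll] at h2
      · exact Hown1 k b i h1 (Sum.inl_injective h2)
      · exact absurd h2 (by simp)
      · exact Hown2 e b i h1 (Sum.inl_injective h2)
    · rcases d with (k | z) | e <;> simp only [omg, wAll] at h2
      · exact absurd (Sum.inl_injective h2) glueSite_ne_glu
      · exact absurd h2 (by simp)
      · exact absurd h2 (by simp)
    · rcases d with (k | z) | e <;> simp [omg, wAll] at h2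

def legN (ℓ : ℕ) (b : Fin 2) (i : ℕ) : TVert ℓ := tLeg b ⟨min i (ℓ + 1), by omega⟩

def pendN {ℓ : ℕ} (hℓ : 0 < ℓ) (b : Fin 3) (i : ℕ) : TVert ℓ := tPend b ⟨min i (ℓ - 1), by omega⟩

def wP {ℓ : ℕ} (hℓ : 0 < ℓ) (b : Fin 2) (i : ℕ) : TVert ℓ :=
  if i = 0 then tRoot ℓ else if i ≤ ℓ + 1 then legN ℓ b (i - 1)
  else pendN hℓ b.castSucc (i - ℓ - 2)

def wQ {ℓ : ℕ} (hℓ : 0 < ℓ) (b : Fin 2) (o i : ℕ) : TVert ℓ :=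
  if i < ℓ then pendN hℓ 2 (ℓ - 1 - i) else if i ≤ 2 * ℓ - o then legN ℓ b (i - ℓ + o)
  else pendN hℓ b.castSucc (i - (2 * ℓ - o) - 1)

def tauP (ℓ r j j' p : ℕ) : ℕ :=
  if p ≤ r then 0 else if p ≤ j - ℓ then 1 else if p ≤ j then p - (j - ℓ) + 1
  else if p ≤ j' then ℓ + 1 else ℓ + 1 + (p - j')

def tauQ (ℓ o i' i j' p : ℕ) : ℕ :=
  if p < i' then p - (i' - ℓ) else if p ≤ i then ℓ else if p ≤ i + ℓ - o then ℓ + (p - i)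
  else if p ≤ j' then 2 * ℓ - o else 2 * ℓ - o + (p - j')

lemma legN_inj {ℓ b b' i i'} (hi : i ≤ ℓ + 1) (hi' : i' ≤ ℓ + 1) (h : legN ℓ b i = legN ℓ b' i') :
    b = b' ∧ i = i' := by
  simp only [legN, Sum.inr.injEq, Sum.inl.injEq, Prod.mk.injEq, Fin.mk.injEq] at h
  exact ⟨h.1, by omega⟩

lemma pendN_inj {ℓ b b' i i'} {hℓ : 0 < ℓ} (hi : i < ℓ) (hi' : i' < ℓ)
    (h : pendN hℓ b i = pendN hℓ b' i') : b = b' ∧ i = i' := by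
  simp only [pendN, Sum.inr.injEq, Sum.inl.injEq, Prod.mk.injEq, Fin.mk.injEq] at h
  exact ⟨h.1, by omega⟩

lemma legN_ne_root {ℓ b i} : legN ℓ b i ≠ tRoot ℓ := by simp [legN]
lemma pendN_ne_root {ℓ b i} {hℓ : 0 < ℓ} : pendN hℓ b i ≠ tRoot ℓ := by simp [pendN]
lemma pendN_ne_leg {ℓ b i b' i'} {hℓ : 0 < ℓ} : pendN hℓ b i ≠ legN ℓ b' i' := by simp [pendN, legN]

lemma wP_winj {ℓ : ℕ} (hℓ : 0 < ℓ) (b : Fin 2) (i i' : ℕ) (h : i ≤ 2 * ℓ + 1) (h' : i' ≤ 2 * ℓ + 1)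
    (e : wP hℓ b i = wP hℓ b i') : i = i' := by
  unfold wP at e
  split_ifs at e
  · omega
  · exact absurd e.symm legN_ne_root
  · exact absurd e.symm pendN_ne_root
  · exact absurd e legN_ne_root
  · have := legN_inj (by omega) (by omega) e
    omega
  · exact absurd e.symm pendN_ne_leg
  · exact absurd e pendN_ne_root
  · exact absurd e pendN_ne_leg
  · have := pendN_inj (by omega) (by omega) e
    omega

lemma wQ_winj {ℓ : ℕ} (hℓ : 0 < ℓ) (b : Fin 2) (o i i' : ℕ) (ho : o ≤ 1) (h : i ≤ 3 * ℓ - o)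
    (h' : i' ≤ 3 * ℓ - o) (e : wQ hℓ b o i = wQ hℓ b o i') : i = i' := by
  unfold wQ at e
  have hb : b.castSucc ≠ (2 : Fin 3) := by fin_cases b <;> decide
  split_ifs at e
  · have := pendN_inj (by omega) (by omega) e
    omega
  · exact absurd e pendN_ne_leg
  · have := pendN_inj (by omega) (by omega) e
    exact absurd this.1.symm hb
  · exact absurd e.symm pendN_ne_leg
  · have := legN_inj (by omega) (by omega) e
    omega
  · exact absurd e.symm pendN_ne_leg
  · have := pendN_inj (by omega) (by omega) e
    exact absurd this.1 hb
  · exact absurd e pendN_ne_leg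
  · have := pendN_inj (by omega) (by omega) e
    omega

lemma wPQ_ne {ℓ : ℕ} (hℓ : 0 < ℓ) (b b' : Fin 2) (hb : b ≠ b') (o i i' : ℕ) (ho : o ≤ 1)
    (h : i ≤ 2 * ℓ + 1) (h' : i' ≤ 3 * ℓ - o) : wP hℓ b i ≠ wQ hℓ b' o i' := by
  intro e
  unfold wP wQ at e
  have hb2 : b.castSucc ≠ (2 : Fin 3) := by fin_cases b <;> decide
  split_ifs at e
  · exact pendN_ne_root e.symm
  · exact legN_ne_root e.symm
  · exact pendN_ne_root e.symm
  · exact pendN_ne_leg e.symm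
  · have := legN_inj (by omega) (by omega) e
    exact hb this.1
  · exact pendN_ne_leg e.symm
  · exact hb2 (pendN_inj (by omega) (by omega) e).1
  · exact pendN_ne_leg e
  · exact hb (Fin.castSucc_injective _ (pendN_inj (by omega) (by omega) e).1)

lemma leg_adj {ℓ three b i} (h : i < ℓ + 1) : (TT ℓ three).Adj (legN ℓ b i) (legN ℓ b (i + 1)) := by
  have := (TC.leg (three := three) b i (by omega : i + 1 < ℓ + 2)).adj
  have e1 : min i (ℓ + 1) = i := by omega
  have e2 : min (i + 1) (ℓ + 1) = i + 1 := by omega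
  simpa only [legN, e1, e2] using this

lemma pend_adj {ℓ three b i} {hℓ : 0 < ℓ} (h : i + 1 < ℓ) :
    (TT ℓ three).Adj (pendN hℓ b i) (pendN hℓ b (i + 1)) := by
  have := (TC.pend (three := three) b i h).adj
  have e1 : min i (ℓ - 1) = i := by omega
  have e2 : min (i + 1) (ℓ - 1) = i + 1 := by omega
  simpa only [pendN, e1, e2] using this

lemma child_adj {ℓ three b} : (TT ℓ three).Adj (tRoot ℓ) (legN ℓ b 0) := (TC.child b).adj

lemma att_adj {ℓ three} {hℓ : 0 < ℓ} (b : Fin 2) :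
    (TT ℓ three).Adj (legN ℓ b ℓ) (pendN hℓ b.castSucc 0) := by
  have := (TC.att (three := three) b.castSucc hℓ).adj
  have e2 : min ℓ (ℓ + 1) = ℓ := by omega
  fin_cases b <;> simpa [pendN, legN, attachPt, e2] using this

lemma att2_adj {ℓ three} {hℓ : 0 < ℓ} : (TT ℓ three).Adj
    (legN ℓ (if three then 1 else 0) (if three then 0 else 1)) (pendN hℓ 2 0) := by
  have := (TC.att (three := three) 2 hℓ).adj
  cases three <;> simpa [pendN, legN, attachPt] using this

lemma wP_path {ℓ three} {hℓ : 0 < ℓ} {b : Fin 2} {i : ℕ} (h : i < 2 * ℓ + 1) :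
    (TT ℓ three).Adj (wP hℓ b i) (wP hℓ b (i + 1)) := by
  unfold wP
  rw [if_neg (show ¬ i + 1 = 0 by omega)]
  by_cases h0 : i = 0
  · subst h0
    rw [if_pos rfl, if_pos (by omega)]
    exact child_adj
  rw [if_neg h0]
  by_cases h1 : i + 1 ≤ ℓ + 1
  · rw [if_pos (by omega), if_pos h1]
    obtain ⟨k, rfl⟩ : ∃ k, i = k + 1 := ⟨i - 1, by omega⟩
    exact leg_adj (by omega)
  rw [if_neg h1]
  by_cases h2 : i ≤ ℓ + 1
  · rw [if_pos h2]
    have e1 : i - 1 = ℓ := by omega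
    have e2 : i + 1 - ℓ - 2 = 0 := by omega
    rw [e1, e2]; exact att_adj b
  · rw [if_neg h2]
    have e2 : i + 1 - ℓ - 2 = i - ℓ - 2 + 1 := by omega
    rw [e2]; exact pend_adj (by omega)

lemma wQ_path {ℓ three} {hℓ : 0 < ℓ} (hℓ2 : 1 < ℓ) {o i : ℕ} (ho : o = if three then 0 else 1)
    (h : i < 3 * ℓ - o) :
    (TT ℓ three).Adj (wQ hℓ (if three then 1 else 0) o i)
      (wQ hℓ (if three then 1 else 0) o (i + 1)) := by
  have ho' : o ≤ 1 := by rw [ho]; split_ifs <;> omega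
  unfold wQ
  generalize hb : (if three = true then (1 : Fin 2) else 0) = b
  split_ifs
  all_goals try omega
  · have e : ℓ - 1 - i = (ℓ - 1 - (i + 1)) + 1 := by omega
    rw [e]; exact (pend_adj (by omega)).symm
  · have e1 : ℓ - 1 - i = 0 := by omega
    have e2 : i + 1 - ℓ + o = o := by omega
    rw [e1, e2, ho, ← hb]; exact att2_adj.symm
  · have e2 : i + 1 - ℓ + o = i - ℓ + o + 1 := by omega
    rw [e2]; exact leg_adj (by omega)
  · have e1 : i - ℓ + o = ℓ := by omega
    have e2 : i + 1 - (2 * ℓ - o) - 1 = 0 := by omega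
    rw [e1, e2]; exact att_adj b
  · have e2 : i + 1 - (2 * ℓ - o) - 1 = i - (2 * ℓ - o) - 1 + 1 := by omega
    rw [e2]; exact pend_adj (by omega)

lemma forall_glue {ℓ : ℕ} {Q : Fin (ℓ + 3) → Prop} (h0 : Q ⟨0, by omega⟩) (h1 : Q ⟨1, by omega⟩)
    (h2 : Q ⟨2, by omega⟩) (h3 : ∀ i : Fin ℓ, Q ⟨i + 3, by omega⟩) : ∀ k, Q k := by
  rintro ⟨k, hk⟩
  match k, hk with
  | 0, _ => exact h0
  | 1, _ => exact h1
  | 2, _ => exact h2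
  | k + 3, hk => exact h3 ⟨k, by omega⟩

def lamG {N ℓ : ℕ} (c0 c1 c2 : Fin N) (leaf : Fin ℓ → Fin N) (k : Fin (ℓ + 3)) : Fin N :=
  if h : 3 ≤ (k : ℕ) then leaf ⟨k - 3, by omega⟩ else if (k : ℕ) = 0 then c0
  else if (k : ℕ) = 1 then c1 else c2

lemma glueSite0 {ℓ h} : glueSite ℓ ⟨0, h⟩ = legN ℓ 0 0 := by simp [glueSite, legN]
lemma glueSite1 {ℓ h} : glueSite ℓ ⟨1, h⟩ = legN ℓ 0 (ℓ + 1) := by simp [glueSite, legN]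
lemma glueSite2 {ℓ h} : glueSite ℓ ⟨2, h⟩ = legN ℓ 1 (ℓ + 1) := by simp [glueSite, legN]
lemma glueSite3 {ℓ} (i : Fin ℓ) {h : (i : ℕ) + 3 < ℓ + 3} : glueSite ℓ ⟨i + 3, h⟩ = tLeaf i := by simp [glueSite]

section
variable {N ℓ : ℕ} {c0 c1 c2 : Fin N} {leaf : Fin ℓ → Fin N}
lemma lamG0 {h} : lamG c0 c1 c2 leaf ⟨0, h⟩ = c0 := by simp [lamG]
lemma lamG1 {h} : lamG c0 c1 c2 leaf ⟨1, h⟩ = c1 := by simp [lamG]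
lemma lamG2 {h} : lamG c0 c1 c2 leaf ⟨2, h⟩ = c2 := by simp [lamG]
lemma lamG3 (i : Fin ℓ) {h : (i : ℕ) + 3 < ℓ + 3} : lamG c0 c1 c2 leaf ⟨i + 3, h⟩ = leaf i := by simp [lamG]
end

lemma wP_root {ℓ} {hℓ : 0 < ℓ} {b} : wP hℓ b 0 = tRoot ℓ := by simp [wP]
lemma wP_leg {ℓ} {hℓ : 0 < ℓ} {b i} (h : i ≤ ℓ) : wP hℓ b (i + 1) = legN ℓ b i := by simp [wP, h]
lemma wP_pend {ℓ} {hℓ : 0 < ℓ} {b i} : wP hℓ b (ℓ + 2 + i) = pendN hℓ b.castSucc i := by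
  unfold wP
  rw [if_neg (by omega), if_neg (by omega)]
  congr 1; omega
lemma wQ_pend2 {ℓ} {hℓ : 0 < ℓ} {b o i} (h : i < ℓ) : wQ hℓ b o (ℓ - 1 - i) = pendN hℓ 2 i := by
  unfold wQ
  rw [if_pos (by omega)]
  congr 1; omega
lemma wQ_leg {ℓ} {hℓ : 0 < ℓ} {b o i} (h : i ≤ ℓ) (h' : o ≤ i) :
    wQ hℓ b o (ℓ + i - o) = legN ℓ b i := by
  unfold wQ
  rw [if_neg (by omega), if_pos (by omega)]
  congr 1; omega
lemma wQ_pend {ℓ} {hℓ : 0 < ℓ} {b o i} (h : o ≤ ℓ) :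
    wQ hℓ b o (2 * ℓ - o + 1 + i) = pendN hℓ b.castSucc i := by
  unfold wQ
  rw [if_neg (by omega), if_neg (by omega)]
  congr 1; omega

structure Conf {V : Type} {N : ℕ} (G : SimpleGraph V) (σ : Fin N → V) (ℓ : ℕ) (fP fQ : ℕ → V)
    (h k j j' i' i jQ jQ' : ℕ) (y u a b : Fin N) (leaf zz : Fin ℓ → Fin N) : Prop where
  hk : h < k
  kj : k + ℓ + 1 ≤ j
  jj : j ≤ j'
  il : ℓ + 1 ≤ i'
  ii : i' ≤ i
  ij : i + ℓ + 1 ≤ jQ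
  qq : jQ ≤ jQ'
  yu : y ≠ u
  ya : y ≠ a
  yb : y ≠ b
  ua : u ≠ a
  ub : u ≠ b
  ab : a ≠ b
  leafinj : Function.Injective leaf
  zzinj : Function.Injective zz
  lz : ∀ x z, leaf x ≠ zz z
  ly : ∀ x, leaf x ≠ y
  lu : ∀ x, leaf x ≠ u
  la : ∀ x, leaf x ≠ a
  lb : ∀ x, leaf x ≠ b
  zy : ∀ x, zz x ≠ y
  zu : ∀ x, zz x ≠ u
  za : ∀ x, zz x ≠ a
  zb : ∀ x, zz x ≠ b
  adju : G.Adj (σ u) (fP k)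
  adjy : G.Adj (σ y) (fP j)
  adja : G.Adj (σ a) (fQ i)
  adjb : G.Adj (σ b) (fQ jQ)
  adjl : ∀ x, ∃ p, h < p ∧ p < k ∧ G.Adj (σ (leaf x)) (fP p)
  adjaP : ∃ p, h < p ∧ p < k ∧ G.Adj (σ a) (fP p)
  P1 : ∀ p t, h ≤ p → p ≤ k → G.Adj (σ t) (fP p) → t ≠ y ∧ t ≠ b ∧ ∀ z, t ≠ zz z
  P2 : ∀ t, G.Adj (σ t) (fP k) → t = u
  P3 : ∀ p t, k < p → p < j → ¬ G.Adj (σ t) (fP p)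
  P4 : ∀ p t, j ≤ p → p ≤ j' + ℓ → G.Adj (σ t) (fP p) → t = y ∧ p ≤ j'
  Q1 : ∀ p t, i' ≤ p + ℓ → p ≤ i → G.Adj (σ t) (fQ p) → t = a ∧ i' ≤ p
  Q2 : ∀ p t, i < p → p < jQ → G.Adj (σ t) (fQ p) → t ≠ y ∧ t ≠ u ∧ t ≠ a ∧ t ≠ b ∧
    (∀ x, t ≠ leaf x) ∧ ∀ z, t ≠ zz z
  Q3 : ∀ p t, jQ ≤ p → p ≤ jQ' + ℓ → G.Adj (σ t) (fQ p) → t = b ∧ p ≤ jQ'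

lemma lamG_ne {N ℓ : ℕ} {c0 c1 c2 x : Fin N} {leaf : Fin ℓ → Fin N} (h0 : c0 ≠ x) (h1 : c1 ≠ x)
    (h2 : c2 ≠ x) (h3 : ∀ i, leaf i ≠ x) : ∀ k, lamG c0 c1 c2 leaf k ≠ x := by
  apply forall_glue
  · rwa [lamG0]
  · rwa [lamG1]
  · rwa [lamG2]
  · intro i; rw [lamG3]; exact h3 i

lemma lamG_inj {N ℓ : ℕ} {c0 c1 c2 : Fin N} {leaf : Fin ℓ → Fin N} (h01 : c0 ≠ c1) (h02 : c0 ≠ c2)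
    (h12 : c1 ≠ c2) (l0 : ∀ i, leaf i ≠ c0) (l1 : ∀ i, leaf i ≠ c1) (l2 : ∀ i, leaf i ≠ c2)
    (hl : Function.Injective leaf) : Function.Injective (lamG c0 c1 c2 leaf) := by
  intro k k' e
  unfold lamG at e
  have := k.2
  have := k'.2
  split_ifs at e <;> apply Fin.ext
  all_goals first
    | omega
    | exact absurd e (l0 _)
    | exact absurd e (l1 _)
    | exact absurd e (l2 _)
    | exact absurd e.symm (l0 _)
    | exact absurd e.symm (l1 _)
    | exact absurd e.symm (l2 _)
    | exact absurd e h01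
    | exact absurd e h02
    | exact absurd e h12
    | exact absurd e.symm h01
    | exact absurd e.symm h02
    | exact absurd e.symm h12
    | (have := congrArg Fin.val (hl e)
       simp only at this
       omega)

lemma tLeg_eq {ℓ : ℕ} (b : Fin 2) (i : ℕ) (h : i < ℓ + 2) :
    (tLeg b ⟨i, h⟩ : TVert ℓ) = legN ℓ b i := by
  have e : min i (ℓ + 1) = i := by omega
  simp only [legN, e]

lemma tPend_eq {ℓ : ℕ} {hℓ : 0 < ℓ} (b : Fin 3) (i : ℕ) (h : i < ℓ) :
    (tPend b ⟨i, h⟩ : TVert ℓ) = pendN hℓ b i := by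
  have e : min i (ℓ - 1) = i := by omega
  simp only [pendN, e]

lemma TC_elim {ℓ : ℕ} {three : Bool} (hℓ : 0 < ℓ) {Q : TVert ℓ → TVert ℓ → Prop}
    (leaf : ∀ i, Q (tRoot ℓ) (tLeaf i)) (child : ∀ b, Q (tRoot ℓ) (legN ℓ b 0))
    (leg : ∀ b i, i ≤ ℓ → Q (legN ℓ b i) (legN ℓ b (i + 1)))
    (pend : ∀ b i, i + 1 < ℓ → Q (pendN hℓ b i) (pendN hℓ b (i + 1)))
    (att : ∀ b : Fin 2, Q (legN ℓ b ℓ) (pendN hℓ b.castSucc 0))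
    (att2 : Q (legN ℓ (if three then 1 else 0) (if three then 0 else 1)) (pendN hℓ 2 0)) :
    ∀ u v, TC ℓ three u v → Q u v := by
  intro u v h
  cases h with
  | leaf i => exact leaf i
  | child b => rw [tLeg_eq]; exact child b
  | leg b i h => rw [tLeg_eq, tLeg_eq]; exact leg b i (by omega)
  | pend b i h => rw [tPend_eq, tPend_eq]; exact pend b i h
  | att p h =>
    rw [tPend_eq (hℓ := hℓ)]
    have e0 : attachPt ℓ three 0 = legN ℓ 0 ℓ := by simp [attachPt, legN]
    have e1 : attachPt ℓ three 1 = legN ℓ 1 ℓ := by simp [attachPt, legN]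
    have e2 : attachPt ℓ three 2 = legN ℓ (if three then 1 else 0) (if three then 0 else 1) := by
      cases three <;> simp [attachPt, legN]
    fin_cases p
    · have := att 0
      rw [← e0] at this; exact this
    · have := att 1
      rw [← e1] at this; exact this
    · rw [← e2] at att2; exact att2

lemma wP_ng {ℓ : ℕ} {hℓ : 0 < ℓ} {b i k p x} : wP hℓ b i ≠ tGlu k p x := by
  unfold wP
  split_ifs <;> simp [legN, pendN]

lemma wQ_ng {ℓ : ℕ} {hℓ : 0 < ℓ} {b o i k p x} : wQ hℓ b o i ≠ tGlu k p x := by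
  unfold wQ
  split_ifs <;> simp [legN, pendN]

lemma wP_ne_leg {ℓ : ℕ} {hℓ : 0 < ℓ} {b c i x} (hx : x ≤ ℓ + 1) (h : b ≠ c ∨ ℓ < x) :
    legN ℓ c x ≠ wP hℓ b i := by
  intro e
  unfold wP at e
  split_ifs at e
  · exact legN_ne_root e
  · have := legN_inj (by omega) (by omega) e
    rcases h with h | h
    · exact h this.1.symm
    · omega
  · exact pendN_ne_leg e.symm

lemma wQ_ne_leg {ℓ : ℕ} {hℓ : 0 < ℓ} {b o c i x} (ho : o ≤ ℓ) (hx : x ≤ ℓ + 1)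
    (h : b ≠ c ∨ x < o ∨ ℓ < x) : legN ℓ c x ≠ wQ hℓ b o i := by
  intro e
  unfold wQ at e
  split_ifs at e
  · exact pendN_ne_leg e.symm
  · have := legN_inj (by omega) (by omega) e
    rcases h with h | h
    · exact h this.1.symm
    · omega
  · exact pendN_ne_leg e.symm

lemma wQ_ne_root {ℓ : ℕ} {hℓ : 0 < ℓ} {b o i} : tRoot ℓ ≠ wQ hℓ b o i := by
  unfold wQ
  split_ifs <;> simp [legN, pendN]

lemma wP_ne_leaf {ℓ : ℕ} {hℓ : 0 < ℓ} {b i x} : tLeaf x ≠ wP hℓ b i := by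
  unfold wP
  split_ifs <;> simp [legN, pendN]

lemma wQ_ne_leaf {ℓ : ℕ} {hℓ : 0 < ℓ} {b o i x} : tLeaf x ≠ wQ hℓ b o i := by
  unfold wQ
  split_ifs <;> simp [legN, pendN]

lemma tauP_s {ℓ r j j' p : ℕ} (h1 : r + ℓ + 1 ≤ j) (h2 : j ≤ j') :
    tauP ℓ r j j' (p + 1) = tauP ℓ r j j' p ∨ tauP ℓ r j j' (p + 1) = tauP ℓ r j j' p + 1 := by
  unfold tauP
  split_ifs <;> omega

lemma tauQ_s {ℓ o i' i j' p : ℕ} (h0 : ℓ + 1 ≤ i') (h1 : i' ≤ i) (h2 : i + ℓ + 1 ≤ j')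
    (ho : o < ℓ) (hp : i' - ℓ ≤ p) :
    tauQ ℓ o i' i j' (p + 1) = tauQ ℓ o i' i j' p ∨
      tauQ ℓ o i' i j' (p + 1) = tauQ ℓ o i' i j' p + 1 := by
  unfold tauQ
  split_ifs <;> omega

section
variable {V : Type} {N ℓ q : ℕ} {G : SimpleGraph V} {σ : Fin N → V} {fP fQ : ℕ → V}
    {h k j j' i' i jQ jQ' : ℕ} {y u a b : Fin N} {leaf zz : Fin ℓ → Fin N}

lemma Conf.Pcase (C : Conf G σ ℓ fP fQ h k j j' i' i jQ jQ' y u a b leaf zz) {p t}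
    (h1 : h ≤ p) (h2 : p ≤ j' + ℓ) (ha : G.Adj (σ t) (fP p)) :
    (p < k ∧ t ≠ y ∧ t ≠ b ∧ ∀ z, t ≠ zz z) ∨ (p = k ∧ t = u) ∨ (j ≤ p ∧ p ≤ j' ∧ t = y) := by
  rcases lt_trichotomy p k with h | h | h
  · exact Or.inl ⟨h, C.P1 p t h1 h.le ha⟩
  · subst h; exact Or.inr (Or.inl ⟨rfl, C.P2 t ha⟩)
  · right; right
    rcases lt_or_ge p j with h' | h'
    · exact absurd ha (C.P3 p t h h')
    · have := C.P4 p t h' h2 ha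
      exact ⟨h', this.2, this.1⟩

lemma Conf.Qcase (C : Conf G σ ℓ fP fQ h k j j' i' i jQ jQ' y u a b leaf zz) {p t}
    (h1 : i' - ℓ ≤ p) (h2 : p ≤ jQ' + ℓ) (ha : G.Adj (σ t) (fQ p)) :
    (i' ≤ p ∧ p ≤ i ∧ t = a) ∨ (t ≠ y ∧ t ≠ u ∧ t ≠ a ∧ t ≠ b ∧
    (∀ x, t ≠ leaf x) ∧ ∀ z, t ≠ zz z) ∨ (jQ ≤ p ∧ p ≤ jQ' ∧ t = b) := by
  rcases le_or_gt p i with h | h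
  · have := C.Q1 p t (by omega) h ha
    exact Or.inl ⟨this.2, h, this.1⟩
  · right
    rcases lt_or_ge p jQ with h' | h'
    · exact Or.inl (C.Q2 p t h h' ha)
    · have := C.Q3 p t h' h2 ha
      exact Or.inr ⟨h', this.2, this.1⟩
end

section
variable {V : Type} {N ℓ q : ℕ} {G : SimpleGraph V} {σ : Fin N → V}
    {h k j j' i' i jQ jQ' : ℕ} {y u a b : Fin N} {leaf zz : Fin ℓ → Fin N}
    {PP : PIdx ℓ → Set V} {n : PIdx ℓ → ℕ} {f : PIdx ℓ → ℕ → V}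

theorem core2 (hℓ : 1 < ℓ) (hPD : ∀ c, PD G σ ℓ q (PP c) (n c) (f c))
    (hcross : ∀ c c', c ≠ c' → ∀ u ∈ PP c, ∀ v ∈ PP c', u ≠ v ∧ ¬ G.Adj u v)
    (σinj : Function.Injective σ) (σind : ∀ s t, ¬ G.Adj (σ s) (σ t))
    (σP : ∀ s c, σ s ∉ PP c)
    (C : Conf G σ ℓ (f (Sum.inl false)) (f (Sum.inl true)) h k j j' i' i jQ jQ' y u a b leaf zz)
    (hn1 : j' + ℓ + 1 < n (Sum.inl false)) (hn2 : jQ' + ℓ + 1 < n (Sum.inl true)) :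
    InducedMinor (TG ℓ false) G := by
  have hℓ0 : 0 < ℓ := by omega
  have c1 := C.hk
  have c2 := C.kj
  have c3 := C.jj
  have c4 := C.il
  have c5 := C.ii
  have c6 := C.ij
  have c7 := C.qq
  refine assemble false G σ Empty PP n f hPD hcross σinj σind σP
    (Sum.elim (Sum.elim (lamG a b y leaf) zz) Empty.elim) ?_
    (fun c => cond c (i' - ℓ) h) (fun c => cond c (jQ' + ℓ) (j' + ℓ))
    (fun c => cond c (3 * ℓ - 1) (2 * ℓ + 1))
    (fun c => cond c (tauQ ℓ 1 i' i jQ') (tauP ℓ (j - ℓ - 1) j j'))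
    (fun c => cond c (wQ hℓ0 0 1) (wP hℓ0 1)) ?_ ?_ ?_ ?_ ?_ ?_ ?_ ?_ ?_ ?_ ?_ ?_ ?_ ?_ ?_
  · refine Function.Injective.sumElim (Function.Injective.sumElim ?_ C.zzinj ?_) ?_ ?_
    · exact lamG_inj C.ab C.ya.symm C.yb.symm C.la C.lb C.ly C.leafinj
    · exact fun k z => lamG_ne (C.za z).symm (C.zb z).symm (C.zy z).symm (fun x => C.lz x z) k
    · exact fun x => x.elim
    · exact fun _ x => x.elim
  · rintro (_ | _) <;> simp only [cond_true, cond_false] <;> omega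
  · rintro (_ | _) <;> simp only [cond_true, cond_false] <;> omega
  · rintro (_ | _) <;> simp only [cond_true, cond_false, tauP, tauQ] <;> split_ifs <;> omega
  · rintro (_ | _) <;> simp only [cond_true, cond_false, tauP, tauQ] <;> split_ifs <;> omega
  · rintro (_ | _) p h1 h2 <;> simp only [cond_true, cond_false] at *
    · exact tauP_s (by omega) (by omega)
    · exact tauQ_s (by omega) (by omega) (by omega) (by omega) h1
  · rintro (_ | _) (_ | _) x x' h1 h2 e <;> simp only [cond_true, cond_false] at *
    · exact ⟨trivial, wP_winj _ _ _ _ h1 h2 e⟩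
    · exact absurd e (wPQ_ne _ _ _ (by decide) _ _ _ (by omega) h1 h2)
    · exact absurd e.symm (wPQ_ne _ _ _ (by decide) _ _ _ (by omega) h2 h1)
    · exact ⟨trivial, wQ_winj _ _ _ _ _ (by omega) h1 h2 e⟩
  · rintro (_ | _) x k p z
    · exact wP_ng
    · exact wQ_ng
  · intro v hv
    rcases v with ⟨⟩ | x | ⟨c, x, hx⟩ | ⟨c, x, hx⟩ | ⟨k, p, x⟩
    · exact Or.inl ⟨false, 0, by simp, wP_root⟩
    · exact Or.inr ⟨_, glueSite3 x (h := by omega)⟩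
    · rw [show (Sum.inr (Sum.inr (Sum.inl (c, ⟨x, hx⟩))) : TVert ℓ) = legN ℓ c x from
        tLeg_eq c x hx]
      by_cases hx1 : x = ℓ + 1
      · subst hx1
        fin_cases c
        · exact Or.inr ⟨⟨1, by omega⟩, glueSite1⟩
        · exact Or.inr ⟨⟨2, by omega⟩, glueSite2⟩
      · fin_cases c
        · by_cases hx0 : x = 0
          · subst hx0
            exact Or.inr ⟨⟨0, by omega⟩, glueSite0⟩
          · exact Or.inl ⟨true, ℓ + x - 1, by simp only [cond_true]; omega,
              wQ_leg (by omega) (by omega)⟩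
        · exact Or.inl ⟨false, x + 1, by simp only [cond_false]; omega, wP_leg (by omega)⟩
    · rw [show (Sum.inr (Sum.inr (Sum.inr (Sum.inl (c, ⟨x, hx⟩)))) : TVert ℓ) = pendN hℓ0 c x from
        tPend_eq c x hx]
      fin_cases c
      · exact Or.inl ⟨true, 2 * ℓ - 1 + 1 + x, by simp only [cond_true]; omega,
          wQ_pend (b := 0) (by omega)⟩
      · exact Or.inl ⟨false, ℓ + 2 + x, by simp only [cond_false]; omega, wP_pend (b := 1)⟩
      · exact Or.inl ⟨true, ℓ - 1 - x, by simp only [cond_true]; omega, wQ_pend2 hx⟩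
    · exact absurd rfl (hv k p x)
  · rintro (_ | _) x hx
    · exact wP_path hx
    · exact wQ_path (three := false) hℓ rfl hx
  · refine fun k c p h1 h2 => ?_
    revert k
    cases c <;> simp only [cond_true, cond_false, Sum.elim_inl] at *
    · have r0 : p < k → wP hℓ0 1 (tauP ℓ (j - ℓ - 1) j j' p) = tRoot ℓ := by
        intro hp
        rw [show tauP ℓ (j - ℓ - 1) j j' p = 0 by unfold tauP; split_ifs <;> omega, wP_root]
      refine forall_glue ?_ ?_ ?_ fun x => ?_
      · rw [lamG0, glueSite0]
        intro ha
        rcases C.Pcase h1 h2 ha with h | h | h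
        · rw [r0 h.1]; exact Or.inr child_adj.symm
        · exact absurd h.2.symm C.ua
        · exact absurd h.2.2.symm C.ya
      · rw [lamG1]
        intro ha
        rcases C.Pcase h1 h2 ha with h | h | h
        · exact absurd rfl h.2.2.1
        · exact absurd h.2.symm C.ub
        · exact absurd h.2.2.symm C.yb
      · rw [lamG2, glueSite2]
        intro ha
        rcases C.Pcase h1 h2 ha with h | h | h
        · exact absurd rfl h.2.1
        · exact absurd h.2 C.yu
        · rw [show tauP ℓ (j - ℓ - 1) j j' p = ℓ + 1 by unfold tauP; split_ifs <;> omega,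
            wP_leg le_rfl]
          exact Or.inr (leg_adj (by omega)).symm
      · rw [lamG3, glueSite3]
        intro ha
        rcases C.Pcase h1 h2 ha with h | h | h
        · rw [r0 h.1]; exact Or.inr (TC.leaf x).adj.symm
        · exact absurd h.2 (C.lu x)
        · exact absurd h.2.2 (C.ly x)
    · refine forall_glue ?_ ?_ ?_ fun x => ?_
      · rw [lamG0, glueSite0]
        intro ha
        rcases C.Qcase h1 h2 ha with h | h | h
        · rw [show tauQ ℓ 1 i' i jQ' p = ℓ + 1 - 1 by unfold tauQ; split_ifs <;> omega,
            wQ_leg (by omega) (by omega)]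
          exact Or.inr (leg_adj (by omega))
        · exact absurd rfl h.2.2.1
        · exact absurd h.2.2 C.ab
      · rw [lamG1, glueSite1]
        intro ha
        rcases C.Qcase h1 h2 ha with h | h | h
        · exact absurd h.2.2.symm C.ab
        · exact absurd rfl h.2.2.2.1
        · rw [show tauQ ℓ 1 i' i jQ' p = ℓ + ℓ - 1 by unfold tauQ; split_ifs <;> omega,
            wQ_leg (by omega) (by omega)]
          exact Or.inr (leg_adj (by omega)).symm
      · rw [lamG2]
        intro ha
        rcases C.Qcase h1 h2 ha with h | h | h
        · exact absurd h.2.2 C.ya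
        · exact absurd rfl h.1
        · exact absurd h.2.2 C.yb
      · rw [lamG3]
        intro ha
        rcases C.Qcase h1 h2 ha with h | h | h
        · exact absurd h.2.2 (C.la x)
        · exact absurd rfl (h.2.2.2.2.1 x)
        · exact absurd h.2.2 (C.lb x)
  · rintro z (_ | _) p h1 h2 ha
    · rcases C.Pcase h1 h2 ha with h | h | h
      · exact h.2.2.2 z rfl
      · exact C.zu z h.2
      · exact C.zy z h.2.2
    · rcases C.Qcase h1 h2 ha with h | h | h
      · exact C.za z h.2.2
      · exact h.2.2.2.2.2 z rfl
      · exact C.zb z h.2.2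
  · exact fun e => e.elim
  · refine TC_elim hℓ0 ?_ ?_ ?_ ?_ ?_ ?_
    · intro x
      obtain ⟨p, p1, p2, p3⟩ := C.adjl x
      refine ⟨_, _, Or.inr ⟨rfl, rfl⟩, Or.inr (Or.inl ⟨⟨x + 3, by omega⟩, false, p, p1.le, ?_, ?_,
        (glueSite3 x).symm, ?_⟩)⟩
      · simp only [cond_false]; omega
      · simp only [Sum.elim_inl]; rw [lamG3]; exact p3
      · simp only [cond_false]
        rw [show tauP ℓ (j - ℓ - 1) j j' p = 0 by unfold tauP; split_ifs <;> omega, wP_root]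
    · intro c
      fin_cases c
      · obtain ⟨p, p1, p2, p3⟩ := C.adjaP
        refine ⟨_, _, Or.inr ⟨rfl, rfl⟩, Or.inr (Or.inl ⟨⟨0, by omega⟩, false, p, p1.le, ?_, ?_,
          glueSite0.symm, ?_⟩)⟩
        · simp only [cond_false]; omega
        · simp only [Sum.elim_inl]; rw [lamG0]; exact p3
        · simp only [cond_false]
          rw [show tauP ℓ (j - ℓ - 1) j j' p = 0 by unfold tauP; split_ifs <;> omega, wP_root]
      · exact ⟨_, _, Or.inl ⟨rfl, rfl⟩, Or.inl ⟨false, 0, by simp, wP_root.symm,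
          (wP_leg (by omega)).symm⟩⟩
    · intro c x hx
      fin_cases c
      · by_cases hx0 : x = 0
        · subst hx0
          refine ⟨_, _, Or.inl ⟨rfl, rfl⟩, Or.inr (Or.inl ⟨⟨0, by omega⟩, true, i, ?_, ?_, ?_,
            glueSite0.symm, ?_⟩)⟩
          · simp only [cond_true]; omega
          · simp only [cond_true]; omega
          · simp only [Sum.elim_inl]; rw [lamG0]; exact C.adja
          · simp only [cond_true]
            rw [show tauQ ℓ 1 i' i jQ' i = ℓ + 1 - 1 by unfold tauQ; split_ifs <;> omega,
              wQ_leg (by omega) (by omega)]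
            rfl
        by_cases hx1 : x = ℓ
        · subst hx1
          refine ⟨_, _, Or.inr ⟨rfl, rfl⟩, Or.inr (Or.inl ⟨⟨1, by omega⟩, true, jQ, ?_, ?_, ?_,
            glueSite1.symm, ?_⟩)⟩
          · simp only [cond_true]; omega
          · simp only [cond_true]; omega
          · simp only [Sum.elim_inl]; rw [lamG1]; exact C.adjb
          · simp only [cond_true]
            rw [show tauQ x 1 i' i jQ' jQ = x + x - 1 by unfold tauQ; split_ifs <;> omega,
              wQ_leg (by omega) (by omega)]
            rfl
        · refine ⟨_, _, Or.inl ⟨rfl, rfl⟩, Or.inl ⟨true, ℓ + x - 1, ?_, ?_, ?_⟩⟩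
          · simp only [cond_true]; omega
          · exact (wQ_leg (by omega) (by omega)).symm
          · simp only [cond_true]
            rw [show ℓ + x - 1 + 1 = ℓ + (x + 1) - 1 by omega]
            exact (wQ_leg (by omega) (by omega)).symm
      · by_cases hx1 : x = ℓ
        · subst hx1
          refine ⟨_, _, Or.inr ⟨rfl, rfl⟩, Or.inr (Or.inl ⟨⟨2, by omega⟩, false, j, ?_, ?_, ?_,
            glueSite2.symm, ?_⟩)⟩
          · simp only [cond_false]; omega
          · simp only [cond_false]; omega
          · simp only [Sum.elim_inl]; rw [lamG2]; exact C.adjy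
          · simp only [cond_false]
            rw [show tauP x (j - x - 1) j j' j = x + 1 by unfold tauP; split_ifs <;> omega,
              wP_leg (by omega)]
            rfl
        · refine ⟨_, _, Or.inl ⟨rfl, rfl⟩, Or.inl ⟨false, x + 1, ?_, ?_, ?_⟩⟩
          · simp only [cond_false]; omega
          · exact (wP_leg (by omega)).symm
          · exact (wP_leg (by omega)).symm
    · intro c x hx
      fin_cases c
      · exact ⟨_, _, Or.inl ⟨rfl, rfl⟩, Or.inl ⟨true, 2 * ℓ - 1 + 1 + x,
          by simp only [cond_true]; omega, (wQ_pend (b := 0) (by omega)).symm,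
          (wQ_pend (b := 0) (by omega)).symm⟩⟩
      · exact ⟨_, _, Or.inl ⟨rfl, rfl⟩, Or.inl ⟨false, ℓ + 2 + x,
          by simp only [cond_false]; omega, (wP_pend (b := 1)).symm, (wP_pend (b := 1)).symm⟩⟩
      · refine ⟨_, _, Or.inr ⟨rfl, rfl⟩, Or.inl ⟨true, ℓ - 1 - (x + 1),
          by simp only [cond_true]; omega, (wQ_pend2 hx).symm, ?_⟩⟩
        simp only [cond_true]
        rw [show ℓ - 1 - (x + 1) + 1 = ℓ - 1 - x by omega]
        exact (wQ_pend2 (by omega)).symm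
    · intro c
      fin_cases c
      · refine ⟨_, _, Or.inl ⟨rfl, rfl⟩, Or.inl ⟨true, ℓ + ℓ - 1,
          by simp only [cond_true]; omega, (wQ_leg (by omega) (by omega)).symm, ?_⟩⟩
        simp only [cond_true]
        rw [show ℓ + ℓ - 1 + 1 = 2 * ℓ - 1 + 1 + 0 by omega]
        exact (wQ_pend (b := 0) (by omega)).symm
      · exact ⟨_, _, Or.inl ⟨rfl, rfl⟩, Or.inl ⟨false, ℓ + 1,
          by simp only [cond_false]; omega, (wP_leg (by omega)).symm,
          (wP_pend (b := 1) (i := 0)).symm⟩⟩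
    · refine ⟨_, _, Or.inr ⟨rfl, rfl⟩, Or.inl ⟨true, ℓ - 1 - 0,
          by simp only [cond_true]; omega, (wQ_pend2 hℓ0).symm, ?_⟩⟩
      simp only [cond_true]
      rw [show ℓ - 1 - 0 + 1 = ℓ + 1 - 1 by omega]
      exact (wQ_leg (i := 1) (by omega) (by omega)).symm
  · refine forall_glue ?_ ?_ ?_ fun x => ?_
    · rw [glueSite0]
      rintro (_ | _) x hx e
      · exact absurd e (wP_ne_leg (by omega) (Or.inl (by decide)))
      · exact absurd e (wQ_ne_leg (by omega) (by omega) (Or.inr (by omega)))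
    · rw [glueSite1]
      rintro (_ | _) x hx e
      · exact absurd e (wP_ne_leg (by omega) (Or.inl (by decide)))
      · exact absurd e (wQ_ne_leg (by omega) (by omega) (Or.inr (by omega)))
    · rw [glueSite2]
      rintro (_ | _) x hx e
      · exact absurd e (wP_ne_leg (by omega) (Or.inr (by omega)))
      · exact absurd e (wQ_ne_leg (by omega) (by omega) (Or.inr (by omega)))
    · rw [glueSite3]
      rintro (_ | _) x hx e
      · exact absurd e wP_ne_leaf
      · exact absurd e wQ_ne_leaf
  · exact fun e => e.elim

theorem core3 (hℓ : 1 < ℓ) (hPD : ∀ c, PD G σ ℓ q (PP c) (n c) (f c))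
    (hcross : ∀ c c', c ≠ c' → ∀ u ∈ PP c, ∀ v ∈ PP c', u ≠ v ∧ ¬ G.Adj u v)
    (σinj : Function.Injective σ) (σind : ∀ s t, ¬ G.Adj (σ s) (σ t))
    (σP : ∀ s c, σ s ∉ PP c)
    (C : Conf G σ ℓ (f (Sum.inl false)) (f (Sum.inl true)) h k j j' i' i jQ jQ' y u a b leaf zz)
    (hn1 : j' + ℓ + 1 < n (Sum.inl false)) (hn2 : jQ' + ℓ + 1 < n (Sum.inl true)) :
    InducedMinor (TG ℓ true) G := by
  have hℓ0 : 0 < ℓ := by omega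
  have c1 := C.hk
  have c2 := C.kj
  have c3 := C.jj
  have c4 := C.il
  have c5 := C.ii
  have c6 := C.ij
  have c7 := C.qq
  refine assemble true G σ Unit PP n f hPD hcross σinj σind σP
    (Sum.elim (Sum.elim (lamG u y b leaf) zz) (fun _ => a)) ?_
    (fun c => cond c (i' - ℓ) h) (fun c => cond c (jQ' + ℓ) (j' + ℓ))
    (fun c => cond c (3 * ℓ - 0) (2 * ℓ + 1))
    (fun c => cond c (tauQ ℓ 0 i' i jQ') (tauP ℓ (k - 1) j j'))
    (fun c => cond c (wQ hℓ0 1 0) (wP hℓ0 0)) ?_ ?_ ?_ ?_ ?_ ?_ ?_ ?_ ?_ ?_ ?_ ?_ ?_ ?_ ?_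
  · refine Function.Injective.sumElim (Function.Injective.sumElim ?_ C.zzinj ?_) ?_ ?_
    · exact lamG_inj C.yu.symm C.ub C.yb C.lu C.ly C.lb C.leafinj
    · exact fun k z => lamG_ne (C.zu z).symm (C.zy z).symm (C.zb z).symm (fun x => C.lz x z) k
    · exact fun _ _ _ => rfl
    · rintro (k | z) _
      · exact lamG_ne C.ua C.ya C.ab.symm C.la k
      · exact C.za z
  · rintro (_ | _) <;> simp only [cond_true, cond_false] <;> omega
  · rintro (_ | _) <;> simp only [cond_true, cond_false] <;> omega
  · rintro (_ | _) <;> simp only [cond_true, cond_false, tauP, tauQ] <;> split_ifs <;> omega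
  · rintro (_ | _) <;> simp only [cond_true, cond_false, tauP, tauQ] <;> split_ifs <;> omega
  · rintro (_ | _) p h1 h2 <;> simp only [cond_true, cond_false] at *
    · exact tauP_s (by omega) (by omega)
    · exact tauQ_s (by omega) (by omega) (by omega) (by omega) h1
  · rintro (_ | _) (_ | _) x x' h1 h2 e <;> simp only [cond_true, cond_false] at *
    · exact ⟨trivial, wP_winj _ _ _ _ h1 h2 e⟩
    · exact absurd e (wPQ_ne _ _ _ (by decide) _ _ _ (by omega) h1 h2)
    · exact absurd e.symm (wPQ_ne _ _ _ (by decide) _ _ _ (by omega) h2 h1)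
    · exact ⟨trivial, wQ_winj _ _ _ _ _ (by omega) h1 h2 e⟩
  · rintro (_ | _) x k p z
    · exact wP_ng
    · exact wQ_ng
  · intro v hv
    rcases v with ⟨⟩ | x | ⟨c, x, hx⟩ | ⟨c, x, hx⟩ | ⟨k, p, x⟩
    · exact Or.inl ⟨false, 0, by simp, wP_root⟩
    · exact Or.inr ⟨_, glueSite3 x (h := by omega)⟩
    · rw [show (Sum.inr (Sum.inr (Sum.inl (c, ⟨x, hx⟩))) : TVert ℓ) = legN ℓ c x from
        tLeg_eq c x hx]
      by_cases hx1 : x = ℓ + 1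
      · subst hx1
        fin_cases c
        · exact Or.inr ⟨⟨1, by omega⟩, glueSite1⟩
        · exact Or.inr ⟨⟨2, by omega⟩, glueSite2⟩
      · fin_cases c
        · exact Or.inl ⟨false, x + 1, by simp only [cond_false]; omega, wP_leg (by omega)⟩
        · exact Or.inl ⟨true, ℓ + x - 0, by simp only [cond_true]; omega,
              wQ_leg (by omega) (by omega)⟩
    · rw [show (Sum.inr (Sum.inr (Sum.inr (Sum.inl (c, ⟨x, hx⟩)))) : TVert ℓ) = pendN hℓ0 c x from
        tPend_eq c x hx]
      fin_cases c
      · exact Or.inl ⟨false, ℓ + 2 + x, by simp only [cond_false]; omega, wP_pend (b := 0)⟩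
      · exact Or.inl ⟨true, 2 * ℓ - 0 + 1 + x, by simp only [cond_true]; omega,
          wQ_pend (b := 1) (by omega)⟩
      · exact Or.inl ⟨true, ℓ - 1 - x, by simp only [cond_true]; omega, wQ_pend2 hx⟩
    · exact absurd rfl (hv k p x)
  · rintro (_ | _) x hx
    · exact wP_path hx
    · exact wQ_path (three := true) hℓ rfl hx
  · refine fun k' c p h1 h2 => ?_
    revert k'
    cases c <;> simp only [cond_true, cond_false, Sum.elim_inl] at *
    · have r0 : p < k → wP hℓ0 0 (tauP ℓ (k - 1) j j' p) = tRoot ℓ := by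
        intro hp
        rw [show tauP ℓ (k - 1) j j' p = 0 by unfold tauP; split_ifs <;> omega, wP_root]
      refine forall_glue ?_ ?_ ?_ fun x => ?_
      · rw [lamG0, glueSite0]
        intro ha
        rcases C.Pcase h1 h2 ha with h | h | h
        · rw [r0 h.1]; exact Or.inr child_adj.symm
        · rw [show tauP ℓ (k - 1) j j' p = 0 + 1 by unfold tauP; split_ifs <;> omega,
            wP_leg (by omega)]
          exact Or.inl rfl
        · exact absurd h.2.2.symm C.yu
      · rw [lamG1, glueSite1]
        intro ha
        rcases C.Pcase h1 h2 ha with h | h | h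
        · exact absurd rfl h.2.1
        · exact absurd h.2 C.yu
        · rw [show tauP ℓ (k - 1) j j' p = ℓ + 1 by unfold tauP; split_ifs <;> omega,
            wP_leg le_rfl]
          exact Or.inr (leg_adj (by omega)).symm
      · rw [lamG2]
        intro ha
        rcases C.Pcase h1 h2 ha with h | h | h
        · exact absurd rfl h.2.2.1
        · exact absurd h.2.symm C.ub
        · exact absurd h.2.2.symm C.yb
      · rw [lamG3, glueSite3]
        intro ha
        rcases C.Pcase h1 h2 ha with h | h | h
        · rw [r0 h.1]; exact Or.inr (TC.leaf x).adj.symm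
        · exact absurd h.2 (C.lu x)
        · exact absurd h.2.2 (C.ly x)
    · refine forall_glue ?_ ?_ ?_ fun x => ?_
      · rw [lamG0]
        intro ha
        rcases C.Qcase h1 h2 ha with h | h | h
        · exact absurd h.2.2 C.ua
        · exact absurd rfl h.2.1
        · exact absurd h.2.2 C.ub
      · rw [lamG1]
        intro ha
        rcases C.Qcase h1 h2 ha with h | h | h
        · exact absurd h.2.2 C.ya
        · exact absurd rfl h.1
        · exact absurd h.2.2 C.yb
      · rw [lamG2, glueSite2]
        intro ha
        rcases C.Qcase h1 h2 ha with h | h | h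
        · exact absurd h.2.2.symm C.ab
        · exact absurd rfl h.2.2.2.1
        · rw [show tauQ ℓ 0 i' i jQ' p = ℓ + ℓ - 0 by unfold tauQ; split_ifs <;> omega,
            wQ_leg (by omega) (by omega)]
          exact Or.inr (leg_adj (by omega)).symm
      · rw [lamG3]
        intro ha
        rcases C.Qcase h1 h2 ha with h | h | h
        · exact absurd h.2.2 (C.la x)
        · exact absurd rfl (h.2.2.2.2.1 x)
        · exact absurd h.2.2 (C.lb x)
  · rintro z (_ | _) p h1 h2 ha
    · rcases C.Pcase h1 h2 ha with h | h | h
      · exact h.2.2.2 z rfl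
      · exact C.zu z h.2
      · exact C.zy z h.2.2
    · rcases C.Qcase h1 h2 ha with h | h | h
      · exact C.za z h.2.2
      · exact h.2.2.2.2.2 z rfl
      · exact C.zb z h.2.2
  · rintro e (_ | _) p h1 h2 ha <;> simp only [cond_true, cond_false, Sum.elim_inr] at *
    · rcases C.Pcase h1 h2 ha with h | h | h
      · rw [show tauP ℓ (k - 1) j j' p = 0 by unfold tauP; split_ifs <;> omega, wP_root]
        exact Or.inl rfl
      · exact absurd h.2.symm C.ua
      · exact absurd h.2.2.symm C.ya
    · rcases C.Qcase h1 h2 ha with h | h | h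
      · rw [show tauQ ℓ 0 i' i jQ' p = ℓ + 0 - 0 by unfold tauQ; split_ifs <;> omega,
            wQ_leg (by omega) (by omega)]
        exact Or.inr child_adj
      · exact absurd rfl h.2.2.1
      · exact absurd h.2.2 C.ab
  · refine TC_elim hℓ0 ?_ ?_ ?_ ?_ ?_ ?_
    · intro x
      obtain ⟨p, p1, p2, p3⟩ := C.adjl x
      refine ⟨_, _, Or.inr ⟨rfl, rfl⟩, Or.inr (Or.inl ⟨⟨x + 3, by omega⟩, false, p, p1.le, ?_, ?_,
        (glueSite3 x).symm, ?_⟩)⟩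
      · simp only [cond_false]; omega
      · simp only [Sum.elim_inl]; rw [lamG3]; exact p3
      · simp only [cond_false]
        rw [show tauP ℓ (k - 1) j j' p = 0 by unfold tauP; split_ifs <;> omega, wP_root]
    · intro c
      fin_cases c
      · exact ⟨_, _, Or.inl ⟨rfl, rfl⟩, Or.inl ⟨false, 0, by simp, wP_root.symm,
          (wP_leg (by omega)).symm⟩⟩
      · refine ⟨_, _, Or.inl ⟨rfl, rfl⟩, Or.inr (Or.inr ⟨(), true, i, ?_, ?_, C.adja, rfl, ?_⟩)⟩
        · simp only [cond_true]; omega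
        · simp only [cond_true]; omega
        · simp only [cond_true]
          rw [show tauQ ℓ 0 i' i jQ' i = ℓ + 0 - 0 by unfold tauQ; split_ifs <;> omega,
              wQ_leg (by omega) (by omega)]
          rfl
    · intro c x hx
      fin_cases c
      · by_cases hx1 : x = ℓ
        · subst hx1
          refine ⟨_, _, Or.inr ⟨rfl, rfl⟩, Or.inr (Or.inl ⟨⟨1, by omega⟩, false, j, ?_, ?_, ?_,
            glueSite1.symm, ?_⟩)⟩
          · simp only [cond_false]; omega
          · simp only [cond_false]; omega
          · simp only [Sum.elim_inl]; rw [lamG1]; exact C.adjy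
          · simp only [cond_false]
            rw [show tauP x (k - 1) j j' j = x + 1 by unfold tauP; split_ifs <;> omega,
              wP_leg (by omega)]
            rfl
        · refine ⟨_, _, Or.inl ⟨rfl, rfl⟩, Or.inl ⟨false, x + 1, ?_, ?_, ?_⟩⟩
          · simp only [cond_false]; omega
          · exact (wP_leg (by omega)).symm
          · exact (wP_leg (by omega)).symm
      · by_cases hx1 : x = ℓ
        · subst hx1
          refine ⟨_, _, Or.inr ⟨rfl, rfl⟩, Or.inr (Or.inl ⟨⟨2, by omega⟩, true, jQ, ?_, ?_, ?_,
            glueSite2.symm, ?_⟩)⟩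
          · simp only [cond_true]; omega
          · simp only [cond_true]; omega
          · simp only [Sum.elim_inl]; rw [lamG2]; exact C.adjb
          · simp only [cond_true]
            rw [show tauQ x 0 i' i jQ' jQ = x + x - 0 by unfold tauQ; split_ifs <;> omega,
              wQ_leg (by omega) (by omega)]
            rfl
        · refine ⟨_, _, Or.inl ⟨rfl, rfl⟩, Or.inl ⟨true, ℓ + x - 0, ?_, ?_, ?_⟩⟩
          · simp only [cond_true]; omega
          · exact (wQ_leg (by omega) (by omega)).symm
          · simp only [cond_true]
            rw [show ℓ + x - 0 + 1 = ℓ + (x + 1) - 0 by omega]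
            exact (wQ_leg (by omega) (by omega)).symm
    · intro c x hx
      fin_cases c
      · exact ⟨_, _, Or.inl ⟨rfl, rfl⟩, Or.inl ⟨false, ℓ + 2 + x,
          by simp only [cond_false]; omega, (wP_pend (b := 0)).symm, (wP_pend (b := 0)).symm⟩⟩
      · exact ⟨_, _, Or.inl ⟨rfl, rfl⟩, Or.inl ⟨true, 2 * ℓ - 0 + 1 + x,
          by simp only [cond_true]; omega, (wQ_pend (b := 1) (by omega)).symm,
          (wQ_pend (b := 1) (by omega)).symm⟩⟩
      · refine ⟨_, _, Or.inr ⟨rfl, rfl⟩, Or.inl ⟨true, ℓ - 1 - (x + 1),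
          by simp only [cond_true]; omega, (wQ_pend2 hx).symm, ?_⟩⟩
        simp only [cond_true]
        rw [show ℓ - 1 - (x + 1) + 1 = ℓ - 1 - x by omega]
        exact (wQ_pend2 (by omega)).symm
    · intro c
      fin_cases c
      · exact ⟨_, _, Or.inl ⟨rfl, rfl⟩, Or.inl ⟨false, ℓ + 1,
          by simp only [cond_false]; omega, (wP_leg (by omega)).symm,
          (wP_pend (b := 0) (i := 0)).symm⟩⟩
      · refine ⟨_, _, Or.inl ⟨rfl, rfl⟩, Or.inl ⟨true, ℓ + ℓ - 0,
          by simp only [cond_true]; omega, (wQ_leg (by omega) (by omega)).symm, ?_⟩⟩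
        simp only [cond_true]
        rw [show ℓ + ℓ - 0 + 1 = 2 * ℓ - 0 + 1 + 0 by omega]
        exact (wQ_pend (b := 1) (by omega)).symm
    · refine ⟨_, _, Or.inr ⟨rfl, rfl⟩, Or.inl ⟨true, ℓ - 1 - 0,
          by simp only [cond_true]; omega, (wQ_pend2 hℓ0).symm, ?_⟩⟩
      simp only [cond_true]
      rw [show ℓ - 1 - 0 + 1 = ℓ + 0 - 0 by omega]
      exact (wQ_leg (i := 0) (by omega) (by omega)).symm
  · refine forall_glue ?_ ?_ ?_ fun x => ?_
    · rw [glueSite0]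
      rintro (_ | _) x hx e
      · refine ⟨k, c1.le, by simp only [cond_false]; omega, ?_, ?_⟩
        · have e' : wP hℓ0 0 (0 + 1) = wP hℓ0 0 x := (wP_leg (by omega)).trans e
          have := wP_winj _ _ _ _ (by omega) hx e'
          subst this
          simp only [cond_false]
          unfold tauP; split_ifs <;> omega
        · simp only [Sum.elim_inl]; rw [lamG0]; exact C.adju
      · exact absurd e (wQ_ne_leg (by omega) (by omega) (Or.inl (by decide)))
    · rw [glueSite1]
      rintro (_ | _) x hx e
      · exact absurd e (wP_ne_leg (by omega) (Or.inr (by omega)))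
      · exact absurd e (wQ_ne_leg (by omega) (by omega) (Or.inr (by omega)))
    · rw [glueSite2]
      rintro (_ | _) x hx e
      · exact absurd e (wP_ne_leg (by omega) (Or.inr (by omega)))
      · exact absurd e (wQ_ne_leg (by omega) (by omega) (Or.inr (by omega)))
    · rw [glueSite3]
      rintro (_ | _) x hx e
      · exact absurd e wP_ne_leaf
      · exact absurd e wQ_ne_leaf
  · rintro _ (_ | _) x hx e
    · obtain ⟨p, p1, p2, p3⟩ := C.adjaP
      refine ⟨p, p1.le, by simp only [cond_false]; omega, ?_, p3⟩
      have e' : wP hℓ0 0 0 = wP hℓ0 0 x := wP_root.trans e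
      have := wP_winj _ _ _ _ (by omega) hx e'
      subst this
      simp only [cond_false]
      unfold tauP; split_ifs <;> omega
    · exact absurd e wQ_ne_root

end

lemma PD.orient {V : Type} {N ℓ q n : ℕ} {G : SimpleGraph V} {σ : Fin N → V} {P : Set V}
    {f : ℕ → V} (hP : PD G σ ℓ q P n f) (hi : Function.Injective σ) (s t : Fin N) (hst : s ≠ t) :
    ∃ f' p0 p1, PD G σ ℓ q P n f' ∧ p0 < p1 ∧ p1 < n ∧ G.Adj (σ s) (f' p0) ∧
      G.Adj (σ t) (f' p1) := by
  obtain ⟨p0, h0, a0⟩ := hP.dom s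
  obtain ⟨p1, h1, a1⟩ := hP.dom t
  rcases le_total p0 p1 with h | h
  · have := hP.ample p0 p1 s t h h1 hst a0 a1
    exact ⟨f, p0, p1, hP, by omega, h1, a0, a1⟩
  · have := hP.ample p1 p0 t s h h0 hst.symm a1 a0
    refine ⟨_, n - 1 - p0, n - 1 - p1, hP.rev, by omega, by omega, ?_, ?_⟩
    · rwa [show n - 1 - (n - 1 - p0) = p0 by omega]
    · rwa [show n - 1 - (n - 1 - p1) = p1 by omega]

lemma pick {N ℓ : ℕ} (A : Finset (Fin N)) (h : ℓ ≤ A.card) :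
    ∃ g : Fin ℓ → Fin N, Function.Injective g ∧ ∀ x, g x ∈ A := by
  obtain ⟨B, hB, hc⟩ := Finset.exists_subset_card_eq h
  exact ⟨B.orderEmbOfFin hc, (B.orderEmbOfFin hc).injective,
    fun x => hB (B.orderEmbOfFin_mem hc x)⟩

theorem statement12 (ℓ q : ℕ) (hq : 1 ≤ q) (hℓq : q < ℓ)
    (V : Type) (G : SimpleGraph V) (SC : Set V) (LC : Set (Set V))
    (hC : IsConstellation G SC LC)
    (hsp : IsSPConst SC LC (2 * (q + 2) * (q + ℓ + 2)) ((2 * ℓ + 3) * ℓ + 2))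
    (hz : IsZigzagged G SC q) (hA : IsAmpleStrong G SC LC (ℓ + 1)) :
    InducedMinor (T2Union ℓ) G ∧ InducedMinor (T3Union ℓ) G := by
  classical
  obtain ⟨hSf, hSc, hLf, hLc⟩ := hsp
  obtain ⟨r, hr, hz⟩ := hz
  obtain ⟨σ, σinj, σS, σr⟩ := exists_enum SC r _ hSf hSc hr
  have hN : 2 * ℓ + 2 * q + 4 ≤ 2 * (q + 2) * (q + ℓ + 2) := by nlinarith
  generalize 2 * (q + 2) * (q + ℓ + 2) = N at *
  have σind : ∀ s t, ¬ G.Adj (σ s) (σ t) := by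
    intro s t h
    exact hC.indep (σS s) (σS t) h.ne h
  have : Finite LC := hLf
  obtain ⟨φ⟩ : Nonempty (PIdx ℓ ≃ LC) := by
    rw [← Finite.card_eq]
    rw [Nat.card_coe_set_eq LC, hLc, Nat.card_eq_fintype_card]
    simp only [Fintype.card_sum, Fintype.card_bool, Fintype.card_prod, Fintype.card_fin]
    ring
  have hcross : ∀ c c', c ≠ c' → ∀ u ∈ (φ c : Set V), ∀ v ∈ (φ c' : Set V),
      u ≠ v ∧ ¬ G.Adj u v := by
    intro c c' hc u hu v hv
    have hne : (φ c : Set V) ≠ φ c' := fun e => hc (φ.injective (Subtype.ext e))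
    refine ⟨?_, hC.pathsSep _ (φ c).2 _ (φ c').2 hne u hu v hv⟩
    rintro rfl
    exact Set.disjoint_left.1 (hC.pathsDisj (φ c).2 (φ c').2 hne) hu hv
  have σP : ∀ s c, σ s ∉ (φ c : Set V) := fun s c h =>
    Set.disjoint_left.1 (hC.pathsOffS _ (φ c).2) h (σS s)
  have hPD : ∀ c, ∃ n f, PD G σ ℓ q (φ c : Set V) n f := fun c =>
    exists_PD hC hSf hz hA σinj σS σr _ (φ c).2
  choose n f hPD using hPD
  obtain ⟨fP, p0, p1, hP, h01, h1n, a0, a1⟩ := (hPD (Sum.inl false)).orient σinj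
    ⟨0, by omega⟩ ⟨2 * ℓ + 2 * q + 3, by omega⟩ (by simp [Fin.ext_iff])
  obtain ⟨h, k, j, j', m, u, y, 𝒜, hk, kj, jj, jn, hm, hu, huy, adju, adjy, atH, inHK, P3, P4,
    h𝒜, h𝒜'⟩ := hP.confP hℓq h01 h1n a0 a1 (by simp) (by simp)
  obtain ⟨s0, hs0⟩ : 𝒜.Nonempty := by
    rw [← Finset.card_pos]; omega
  obtain ⟨s1, hs1, hs1m⟩ : ∃ s1 : Fin N, (s1 : ℕ) ≤ ℓ + 1 ∧ s1 ≠ m := by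
    by_cases hm0 : (m : ℕ) = 0
    · exact ⟨⟨1, by omega⟩, by simp, fun e => by simp [← e] at hm0⟩
    · exact ⟨⟨0, by omega⟩, by simp, fun e => by simp [← e] at hm0⟩
  obtain ⟨fQ, r0, r1, hQ, hr01, hr1n, b0, b1⟩ := (hPD (Sum.inl true)).orient σinj
    s0 s1 (fun e => by have := (h𝒜' s0 hs0).1; rw [e] at this; omega)
  obtain ⟨i', i, jQ, jQ', a, b, il, ii, ij, qq, qn, ha, hb, hbm, adja, adjb, Q1, Q2, Q3⟩ :=
    hQ.confQ (m := m) (u := u) hℓq 𝒜 h𝒜 (fun t ht => ⟨(h𝒜' t ht).1, (h𝒜' t ht).2.1⟩) hr01 hr1n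
      b0 b1 hs0 hs1 hs1m
  obtain ⟨leaf, leafinj, hleaf⟩ := pick (ℓ := ℓ) (𝒜.erase a) (by
    rw [Finset.card_erase_of_mem ha]; omega)
  have hzc : ℓ ≤ (((Finset.univ.map (Fin.castLEEmb (show ℓ + 2 ≤ N by omega))).erase m).erase
      b).card := by
    have e1 := Finset.pred_card_le_card_erase
      (s := (Finset.univ.map (Fin.castLEEmb (show ℓ + 2 ≤ N by omega)))) (a := m)
    have e2 := Finset.pred_card_le_card_erase
      (s := (Finset.univ.map (Fin.castLEEmb (show ℓ + 2 ≤ N by omega))).erase m) (a := b)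
    have e3 : (Finset.univ.map (Fin.castLEEmb (show ℓ + 2 ≤ N by omega))).card = ℓ + 2 := by
      simp
    omega
  obtain ⟨zz, zzinj, hzz⟩ := pick _ hzc
  have hzz' : ∀ z, (zz z : ℕ) ≤ ℓ + 1 ∧ zz z ≠ m ∧ zz z ≠ b := by
    intro z
    have := hzz z
    rw [Finset.mem_erase, Finset.mem_erase, Finset.mem_map] at this
    obtain ⟨g1, g2, x, -, g3⟩ := this
    refine ⟨?_, g2, g1⟩
    rw [← g3]
    have := x.2
    simp only [Fin.castLEEmb_apply, Fin.val_castLE]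
    omega
  have hleaf' : ∀ x, leaf x ≠ a ∧ leaf x ∈ 𝒜 := fun x => Finset.mem_erase.1 (hleaf x)
  have hA1 : ∀ t ∈ 𝒜, ℓ + 1 < (t : ℕ) ∧ (t : ℕ) < u := fun t ht =>
    ⟨(h𝒜' t ht).1, (h𝒜' t ht).2.1⟩
  have ha1 := hA1 a ha
  have hl1 := fun x => hA1 _ (hleaf' x).2
  have vne : ∀ s t : Fin N, (s : ℕ) ≠ t → s ≠ t := fun s t h e => h (congrArg _ e)
  have C : Conf G σ ℓ fP fQ h k j j' i' i jQ jQ' y u a b leaf zz := {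
    hk := hk, kj := kj, jj := jj, il := il, ii := ii, ij := ij, qq := qq
    yu := vne _ _ (by omega)
    ya := vne _ _ (by omega)
    yb := vne _ _ (by omega)
    ua := vne _ _ (by omega)
    ub := vne _ _ (by omega)
    ab := vne _ _ (by omega)
    leafinj := leafinj
    zzinj := zzinj
    lz := fun x z => vne _ _ (by have := hl1 x; have := (hzz' z).1; omega)
    ly := fun x => vne _ _ (by have := hl1 x; omega)
    lu := fun x => vne _ _ (by have := hl1 x; omega)
    la := fun x => (hleaf' x).1
    lb := fun x => vne _ _ (by have := hl1 x; omega)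
    zy := fun z => vne _ _ (by have := (hzz' z).1; omega)
    zu := fun z => vne _ _ (by have := (hzz' z).1; omega)
    za := fun z => vne _ _ (by have := (hzz' z).1; omega)
    zb := fun z => (hzz' z).2.2
    adju := adju, adjy := adjy, adja := adja, adjb := adjb
    adjl := fun x => (h𝒜' _ (hleaf' x).2).2.2
    adjaP := (h𝒜' _ ha).2.2
    P1 := by
      intro p t h1 h2 hadj
      rcases h1.eq_or_lt with e | e
      · subst e
        have := atH t hadj
        subst this
        exact ⟨vne _ _ (by omega), hbm.symm, fun z => (hzz' z).2.1.symm⟩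
      · obtain ⟨g1, g2⟩ := inHK p t e h2 hadj
        exact ⟨g2.ne, vne _ _ (by omega), fun z => vne _ _ (by have := (hzz' z).1; omega)⟩
    P2 := fun t hadj => hP.uniq (by omega) hadj adju
    P3 := P3
    P4 := P4
    Q1 := Q1
    Q2 := by
      intro p t h1 h2 hadj
      obtain ⟨g1, g2, g3⟩ := Q2 p t h1 h2 hadj
      rw [Fin.lt_def] at g3
      refine ⟨vne _ _ (by omega), vne _ _ (by omega), fun e => g1 (e ▸ ha), ?_,
        fun x e => g1 (e ▸ (hleaf' x).2), fun z => ?_⟩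
      · rcases g2 with g2 | g2
        · exact vne _ _ (by omega)
        · exact fun e => hbm (e.symm.trans g2)
      · rcases g2 with g2 | g2
        · exact vne _ _ (by have := (hzz' z).1; omega)
        · exact fun e => (hzz' z).2.1 (e.symm.trans g2)
    Q3 := Q3 }
  have hPD' : ∀ c, PD G σ ℓ q (φ c : Set V) (n c)
      (Sum.elim (fun c => cond c fQ fP) (fun x => f (Sum.inr x)) c) := by
    rintro ((_ | _) | x)
    · exact hP
    · exact hQ
    · exact hPD _
  exact ⟨core2 (by omega) hPD' hcross σinj σind σP C jn qn,
    core3 (by omega) hPD' hcross σinj σind σP C jn qn⟩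

end Paper
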